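/- (In ZF + AD^{L(ℝ)}) HP(HOD) does not hold. -/

import Mathlib

/-!
Common set-theoretic infrastructure for formalizing the paper
"The strong reflecting property and Harrington's Principle".

We work over Mathlib's `ZFSet.{0}` (a model of ZFC).  First-order satisfaction
for the language of set theory (with two auxiliary unary predicates) is
defined directly; Gödel's constructible hierarchy `L` (and its relativized
versions `L[A]`), hereditarily-small sets `H_κ`, transitive collapses,
clubs, elementary submodels, admissible ordinals, and the various
reflecting properties are all defined from first principles.
-/

noncomputable section
attribute [local instance] Classical.propDecidable
namespace SRPPaper

open ZFSet

/-- Image of a `ZFSet.{0}` under an arbitrary (classically definable) function. -/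
def img (f : ZFSet.{0} → ZFSet.{0}) : ZFSet.{0} → ZFSet.{0} :=
  @ZFSet.image f (Classical.allZFSetDefinable _)

/-! ### First-order formulas and satisfaction -/

/-- First-order formulas in the language `{∈, =, A, B}` where `A`, `B` are
unary predicate symbols; variables are de Bruijn-style indices in `Fin n`. -/
inductive Fml : ℕ → Type
  | mem {n} (i j : Fin n) : Fml n
  | eq {n} (i j : Fin n) : Fml n
  | inA {n} (i : Fin n) : Fml n
  | inB {n} (i : Fin n) : Fml n
  | not {n} : Fml n → Fml n
  | and {n} : Fml n → Fml n → Fml n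
  | ex {n} : Fml (n + 1) → Fml n

/-- Satisfaction over the structure `(S, ∈, A, B)`; quantifiers range over `S`,
the new variable of `ex` gets index `0`. -/
def SatAB (S A B : Set ZFSet.{0}) : ∀ {n}, Fml n → (Fin n → ZFSet.{0}) → Prop
  | _, .mem i j, v => v i ∈ v j
  | _, .eq i j, v => v i = v j
  | _, .inA i, v => v i ∈ A
  | _, .inB i, v => v i ∈ B
  | _, .not φ, v => ¬ SatAB S A B φ v
  | _, .and φ ψ, v => SatAB S A B φ v ∧ SatAB S A B ψ v
  | _, .ex φ, v => ∃ x ∈ S, SatAB S A B φ (Fin.cons x v)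

/-- Pure `∈`-satisfaction over the structure `(S, ∈)`. -/
def Sat (S : Set ZFSet.{0}) {n} (φ : Fml n) (v : Fin n → ZFSet.{0}) : Prop :=
  SatAB S ∅ ∅ φ v

/-- Δ₀ (bounded) formulas. -/
inductive IsDelta0 : ∀ {n}, Fml n → Prop
  | mem {n} (i j : Fin n) : IsDelta0 (.mem i j)
  | eq {n} (i j : Fin n) : IsDelta0 (.eq i j)
  | inA {n} (i : Fin n) : IsDelta0 (.inA i)
  | inB {n} (i : Fin n) : IsDelta0 (.inB i)
  | not {n} {φ : Fml n} : IsDelta0 φ → IsDelta0 (.not φ)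
  | and {n} {φ ψ : Fml n} : IsDelta0 φ → IsDelta0 ψ → IsDelta0 (.and φ ψ)
  | bex {n} (j : Fin (n + 1)) {φ : Fml (n + 1)} : j ≠ 0 → IsDelta0 φ →
      IsDelta0 (.ex (.and (.mem 0 j) φ))

/-- A Gödel code for formulas. -/
def codeF : ∀ {n}, Fml n → ℕ
  | _, .mem i j => Nat.pair 0 (Nat.pair i.val j.val)
  | _, .eq i j => Nat.pair 1 (Nat.pair i.val j.val)
  | _, .inA i => Nat.pair 2 i.val
  | _, .inB i => Nat.pair 3 i.val
  | _, .not φ => Nat.pair 4 (codeF φ)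
  | _, .and φ ψ => Nat.pair 5 (Nat.pair (codeF φ) (codeF ψ))
  | _, .ex φ => Nat.pair 6 (codeF φ)

/-! ### Ordinals, von Neumann naturals -/

/-- `x` is a (von Neumann) ordinal: a transitive set of transitive sets. -/
def IsOrd (x : ZFSet.{0}) : Prop :=
  x.IsTransitive ∧ ∀ y ∈ x, ZFSet.IsTransitive y

/-- `x` is a limit ordinal. -/
def IsLimitOrd (x : ZFSet.{0}) : Prop :=
  IsOrd x ∧ x ≠ ∅ ∧ ∀ y ∈ x, ∃ z ∈ x, y ∈ z

/-- The `n`-th von Neumann natural number. -/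
def natZ : ℕ → ZFSet.{0}
  | 0 => ∅
  | n + 1 => insert (natZ n) (natZ n)

/-- Decoding of von Neumann naturals. -/
def zfToNat (x : ZFSet.{0}) : ℕ :=
  if h : ∃ n : ℕ, natZ n = x then h.choose else 0

/-! ### Coded functions, products -/

/-- The cartesian product of two `ZFSet.{0}`s (as a set of Kuratowski pairs). -/
def prodZ (a b : ZFSet.{0}) : ZFSet.{0} :=
  ZFSet.sep (fun z => ∃ x, x ∈ a ∧ ∃ y, y ∈ b ∧ z = ZFSet.pair x y)
    (ZFSet.powerset (ZFSet.powerset (a ∪ b)))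

/-- `f` codes a surjection from `a` onto `b`. -/
def IsSurjF (a b f : ZFSet.{0}) : Prop :=
  ZFSet.IsFunc a b f ∧ ∀ y, y ∈ b → ∃ x, x ∈ a ∧ ZFSet.pair x y ∈ f

/-- `f` codes an injection from `a` into `b`. -/
def IsInjF (a b f : ZFSet.{0}) : Prop :=
  ZFSet.IsFunc a b f ∧
    ∀ x₁, x₁ ∈ a → ∀ x₂, x₂ ∈ a → ∀ y, ZFSet.pair x₁ y ∈ f → ZFSet.pair x₂ y ∈ f → x₁ = x₂

/-- The set of values of a coded function `f`. -/
def imageOf (f : ZFSet.{0}) : ZFSet.{0} :=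
  ZFSet.sep (fun y => ∃ x, ZFSet.pair x y ∈ f) (ZFSet.sUnion (ZFSet.sUnion f))

/-! ### Cardinals (in `V`) -/

/-- `x` and `y` are equinumerous. -/
def EqNum (x y : ZFSet.{0}) : Prop := Nonempty (x.toSet ≃ y.toSet)

/-- `|x| ≤ |y|`. -/
def CardLE (x y : ZFSet.{0}) : Prop := Nonempty (x.toSet ↪ y.toSet)

/-- `|x| < κ`, for `κ` a cardinal: `x` injects into some member of `κ`. -/
def CardLT (x κ : ZFSet.{0}) : Prop := ∃ α, α ∈ κ ∧ CardLE x α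

/-- `κ` is a cardinal (of `V`). -/
def IsCard (κ : ZFSet.{0}) : Prop := IsOrd κ ∧ ∀ α ∈ κ, ¬ EqNum α κ

/-- `x` is unbounded (cofinal) in the ordinal `κ`. -/
def UnbIn (x κ : ZFSet.{0}) : Prop := ∀ β ∈ κ, ∃ γ ∈ x, β ∈ γ ∨ β = γ

/-- `κ` is a regular cardinal: every cofinal subset of `κ` has size `κ`. -/
def IsRegular (κ : ZFSet.{0}) : Prop :=
  IsCard κ ∧ ∀ x : ZFSet.{0}, x ⊆ κ → UnbIn x κ → EqNum x κ

/-- The least ordinal satisfying `p` (junk value `∅` if there is none). -/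
def leastOrd (p : ZFSet.{0} → Prop) : ZFSet.{0} :=
  if h : ∃ α, (IsOrd α ∧ p α) ∧ ∀ β ∈ α, ¬ (IsOrd β ∧ p β) then h.choose else ∅

/-- The cardinal `ℵₙ` of `V` (`Aleph 0 = ω`). -/
def Aleph : ℕ → ZFSet.{0}
  | 0 => ZFSet.omega
  | n + 1 => leastOrd (fun κ => IsCard κ ∧ Aleph n ∈ κ)

/-- The cardinal successor (in `V`) of `κ`. -/
def SuccCard (κ : ZFSet.{0}) : ZFSet.{0} := leastOrd (fun α => IsCard α ∧ κ ∈ α)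

/-- `X` is countable. -/
def Ctbl (X : ZFSet.{0}) : Prop := X.toSet.Countable

/-- `|X| = ω`: `X` is countably infinite. -/
def CtblInf (X : ZFSet.{0}) : Prop := X.toSet.Countable ∧ X.toSet.Infinite

/-! ### `H_κ`, elementary submodels, transitive collapse -/

/-- The class `H_κ` of sets hereditarily of cardinality `< κ`. -/
def Hset (κ : ZFSet.{0}) : Set ZFSet.{0} :=
  {x | ∃ t : ZFSet.{0}, t.IsTransitive ∧ x ∈ t ∧ CardLT t κ}

/-- `X ≺ S`: `X` is an elementary submodel of the class `(S, ∈)`. -/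
def ElemSub (X : ZFSet.{0}) (S : Set ZFSet.{0}) : Prop :=
  X.toSet ⊆ S ∧ ∀ {n : ℕ} (φ : Fml n) (v : Fin n → ZFSet.{0}),
    (∀ i, v i ∈ X) → (Sat X.toSet φ v ↔ Sat S φ v)

/-- The transitive-collapse map of (the ∈-structure on) `X`:
`collapse X y = {collapse X z | z ∈ y ∩ X}`.  For `γ ∈ X`, `collapse X γ` is
the image `γ̄` of `γ` under the transitive collapse of `X`. -/
def collapse (X : ZFSet.{0}) : ZFSet.{0} → ZFSet.{0} :=
  ZFSet.mem_wf.fix (C := fun _ => ZFSet.{0}) fun y ih =>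
    img (fun z => if h : z ∈ y then ih z h else ∅) (ZFSet.sep (fun z => z ∈ X) y)

/-- The transitive collapse of `X` (as a set). -/
def collapseSet (X : ZFSet.{0}) : ZFSet.{0} := img (fun y => collapse X y) X

/-- The transitive closure of (the members of) `x`. -/
def tcl : ZFSet.{0} → ZFSet.{0} :=
  ZFSet.mem_wf.fix (C := fun _ => ZFSet.{0}) fun x ih =>
    x ∪ ZFSet.sUnion (img (fun y => if h : y ∈ x then ih y h else ∅) x)

/-- The (von Neumann) rank of a set, as an ordinal `ZFSet.{0}`. -/
def rankZ : ZFSet.{0} → ZFSet.{0} :=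
  ZFSet.mem_wf.fix (C := fun _ => ZFSet.{0}) fun x ih =>
    ZFSet.sUnion (img (fun y => if h : y ∈ x then insert (ih y h) (ih y h) else ∅) x)

/-- The order type of a set `X` of ordinals: the unique ordinal `α` such that
`(X, ∈) ≅ (α, ∈)` (junk value `∅` if there is none). -/
def otype (X : ZFSet.{0}) : ZFSet.{0} :=
  if h : ∃ α, IsOrd α ∧ ∃ e : X.toSet ≃ α.toSet,
      ∀ a b : X.toSet, (a : ZFSet.{0}) ∈ (b : ZFSet.{0}) ↔ ((e a : ZFSet.{0}) ∈ (e b : ZFSet.{0}))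
  then h.choose else ∅

/-! ### The constructible hierarchy (relative to a predicate) -/

/-- The set of subsets of `X` definable over `(X, ∈, A)` with parameters. -/
def DefSetA (A : Set ZFSet.{0}) (X : ZFSet.{0}) : ZFSet.{0} :=
  ZFSet.sep (fun B => ∃ (n : ℕ) (φ : Fml (n + 1)) (v : Fin n → ZFSet.{0}),
      (∀ i, v i ∈ X) ∧ B = ZFSet.sep (fun z => SatAB X.toSet A ∅ φ (Fin.cons z v)) X)
    (ZFSet.powerset X)

/-- The hierarchy `L_α[A]`: `LstageA A α = ⋃_{β ∈ α} Def_A (LstageA A β)`. -/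
def LstageA (A : Set ZFSet.{0}) : ZFSet.{0} → ZFSet.{0} :=
  ZFSet.mem_wf.fix (C := fun _ => ZFSet.{0}) fun α ih =>
    ZFSet.sUnion (img (fun β => if h : β ∈ α then DefSetA A (ih β h) else ∅) α)

/-- Gödel's hierarchy `L_α`. -/
def Lstage : ZFSet.{0} → ZFSet.{0} := LstageA ∅

/-- The constructible universe `L`, as a class. -/
def LClass : Set ZFSet.{0} := {x | ∃ α, IsOrd α ∧ x ∈ Lstage α}

/-- The class `L[A]`, for a set `A`. -/
def LrelClass (A : ZFSet.{0}) : Set ZFSet.{0} := {x | ∃ α, IsOrd α ∧ x ∈ LstageA A.toSet α}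

/-- The constructible universe as computed inside a transitive (set or class)
model `W`: the union of the `L_α` for `α` an ordinal of `W`. -/
def LClassIn (W : Set ZFSet.{0}) : Set ZFSet.{0} :=
  {x | ∃ α, IsOrd α ∧ α ∈ W ∧ x ∈ Lstage α}

/-- `κ` is a cardinal in the (transitive) class `W`:
no coded surjection lying in `W` maps some `α < κ` onto `κ`. -/
def CardIn (W : Set ZFSet.{0}) (κ : ZFSet.{0}) : Prop :=
  IsOrd κ ∧ ∀ α, α ∈ κ → ∀ f, f ∈ W → ¬ IsSurjF α κ f

/-- `κ` is an `L`-cardinal. -/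
def LCard (κ : ZFSet.{0}) : Prop := CardIn LClass κ

/-! ### Clubs and stationarity on `[S]^ω` and on `κ` -/

/-- The union of an `ℕ`-indexed family of `ZFSet.{0}`s. -/
def seqUnion (f : ℕ → ZFSet.{0}) : ZFSet.{0} :=
  ZFSet.sUnion (img (fun m => f (zfToNat m)) ZFSet.omega)

/-- `C` is a club of countable subsets of `S`: every member is a countable
subset of `S`, `C` is `⊆`-cofinal in the countable subsets of `S`, and `C` is
closed under unions of countable increasing chains. -/
def ClubSub (S : Set ZFSet.{0}) (C : Set ZFSet.{0}) : Prop :=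
  (∀ X ∈ C, (X : ZFSet.{0}).toSet ⊆ S ∧ CtblInf X) ∧
  (∀ X : ZFSet.{0}, X.toSet ⊆ S → CtblInf X → ∃ Y ∈ C, X ⊆ Y) ∧
  (∀ f : ℕ → ZFSet.{0}, (∀ n, f n ∈ C) → (∀ n, f n ⊆ f (n + 1)) → seqUnion f ∈ C)

/-- `C` is stationary in `[S]^ω`: it meets every club of countable subsets. -/
def StatSub (S : Set ZFSet.{0}) (C : Set ZFSet.{0}) : Prop :=
  ∀ D : Set ZFSet.{0}, ClubSub S D → ∃ X, X ∈ C ∧ X ∈ D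

/-- `D` is a club (closed unbounded set) in the ordinal `κ`. -/
def ClubIn (κ D : ZFSet.{0}) : Prop :=
  D ⊆ κ ∧ (∀ β ∈ κ, ∃ θ, θ ∈ D ∧ β ∈ θ) ∧
  ∀ α, α ∈ κ → α ≠ ∅ → (∀ β ∈ α, ∃ θ, θ ∈ D ∧ θ ∈ α ∧ (β ∈ θ ∨ β = θ)) → α ∈ D

/-- `D` is stationary in the ordinal `κ`. -/
def StatIn (κ D : ZFSet.{0}) : Prop :=
  D ⊆ κ ∧ ∀ C : ZFSet.{0}, ClubIn κ C → ∃ θ, θ ∈ D ∧ θ ∈ C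

/-! ### The strong and weak reflecting properties -/

/-- `SRP^M(γ)` for an inner model given as a class `W`:  for some regular
cardinal `κ > γ`, whenever `X ≺ H_κ` is countable with `γ ∈ X`, the image of
`γ` under the transitive collapse of `X` is a cardinal of `W`. -/
def SRPclass (W : Set ZFSet.{0}) (γ : ZFSet.{0}) : Prop :=
  ∃ κ, IsRegular κ ∧ γ ∈ κ ∧
    ∀ X : ZFSet.{0}, ElemSub X (Hset κ) → CtblInf X → γ ∈ X → CardIn W (collapse X γ)

/-- `SRP^L(γ)`: the strong reflecting property for `L`-cardinals. -/
def SRPL (γ : ZFSet.{0}) : Prop := SRPclass LClass γ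

/-- `WRP^L(γ)`: the weak reflecting property for `L`-cardinals. -/
def WRPL (γ : ZFSet.{0}) : Prop :=
  ∃ κ, IsRegular κ ∧ γ ∈ κ ∧
    ∃ X : ZFSet.{0}, ElemSub X (Hset κ) ∧ CtblInf X ∧ γ ∈ X ∧ LCard (collapse X γ)

/-- `SRP^M_{<λ}(λ)`: for some regular `θ > λ`, every `X ≺ H_θ` with `|X| < λ`
and `λ ∈ X` collapses `λ` to a `W`-cardinal. -/
def SRPlt (W : Set ZFSet.{0}) (lam : ZFSet.{0}) : Prop :=
  ∃ θ, IsRegular θ ∧ lam ∈ θ ∧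
    ∀ X : ZFSet.{0}, ElemSub X (Hset θ) → CardLT X lam → lam ∈ X → CardIn W (collapse X lam)

/-! ### Notions relativized to a transitive (set or class) model `W` -/

/-- `κ` is a regular cardinal in `W`: `κ` is a `W`-cardinal and every coded
function in `W` from some `α < κ` into `κ` is bounded. -/
def RegularIn (W : Set ZFSet.{0}) (κ : ZFSet.{0}) : Prop :=
  CardIn W κ ∧ ∀ α, α ∈ κ → ∀ f, f ∈ W → ZFSet.IsFunc α κ f →
    ∃ β, β ∈ κ ∧ ∀ ξ y, ξ ∈ α → ZFSet.pair ξ y ∈ f → y ∈ β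

/-- `H_κ` as computed in `W`. -/
def HsetIn (W : Set ZFSet.{0}) (κ : ZFSet.{0}) : Set ZFSet.{0} :=
  {x | x ∈ W ∧ ∃ t, t ∈ W ∧ t.IsTransitive ∧ x ∈ t ∧
    ∃ f, f ∈ W ∧ ∃ α, α ∈ κ ∧ IsInjF t α f}

/-- `X` is countable in `W`. -/
def CtblIn (W : Set ZFSet.{0}) (X : ZFSet.{0}) : Prop :=
  X = ∅ ∨ ∃ f, f ∈ W ∧ IsSurjF ZFSet.omega X f

/-- `|X| = ω` in `W`: countable and infinite in `W`. -/
def CtblInfIn (W : Set ZFSet.{0}) (X : ZFSet.{0}) : Prop :=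
  CtblIn W X ∧ ∀ n, n ∈ ZFSet.omega → ∀ f, f ∈ W → ¬ IsSurjF n X f

/-- The `ω₁` of `W`. -/
def omega1In (W : Set ZFSet.{0}) : ZFSet.{0} :=
  leastOrd (fun α => CardIn W α ∧ ZFSet.omega ∈ α)

/-- The `ω₂` of `W`. -/
def omega2In (W : Set ZFSet.{0}) : ZFSet.{0} :=
  leastOrd (fun α => CardIn W α ∧ omega1In W ∈ α)

/-- The cardinal successor of `κ` as computed in `W`. -/
def SuccCardIn (W : Set ZFSet.{0}) (κ : ZFSet.{0}) : ZFSet.{0} :=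
  leastOrd (fun α => CardIn W α ∧ κ ∈ α)

/-- `WRP^L(γ)` as computed inside the (transitive) model `W`:  for some
`κ ∈ W` regular in `W` with `γ < κ` there is an `X ∈ W`, countably infinite
in `W`, with `X ≺ H_κ^W`, `γ ∈ X`, whose collapse sends `γ` to a cardinal of
the `L` of `W`. -/
def WRPLIn (W : Set ZFSet.{0}) (γ : ZFSet.{0}) : Prop :=
  ∃ κ, κ ∈ W ∧ RegularIn W κ ∧ γ ∈ κ ∧
    ∃ X, X ∈ W ∧ ElemSub X (HsetIn W κ) ∧ CtblInfIn W X ∧ γ ∈ X ∧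
      CardIn (LClassIn W) (collapse X γ)

/-- `SRP^L(γ)` as computed inside the (transitive) model `W`. -/
def SRPLIn (W : Set ZFSet.{0}) (γ : ZFSet.{0}) : Prop :=
  ∃ κ, κ ∈ W ∧ RegularIn W κ ∧ γ ∈ κ ∧
    ∀ X, X ∈ W → ElemSub X (HsetIn W κ) → CtblInfIn W X → γ ∈ X →
      CardIn (LClassIn W) (collapse X γ)

/-! ### Models of (fragments of) ZFC, semantically -/

/-- `W` is a transitive model of `ZFC⁻` (ZFC with Power Set deleted and with
Collection), rendered semantically: nonempty, transitive, closed under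
pairing and union, contains `ω`, satisfies full Separation and Collection for
first-order formulas with parameters, and Choice. -/
def ModelsZFCminus (W : Set ZFSet.{0}) : Prop :=
  (∃ x, x ∈ W) ∧
  (∀ x, x ∈ W → x.toSet ⊆ W) ∧
  (∀ x y, x ∈ W → y ∈ W → insert x (insert y (∅ : ZFSet.{0})) ∈ W) ∧
  (∀ x, x ∈ W → ZFSet.sUnion x ∈ W) ∧
  (ZFSet.omega ∈ W) ∧
  (∀ (n : ℕ) (φ : Fml (n + 1)) (v : Fin n → ZFSet.{0}), (∀ i, v i ∈ W) → ∀ a, a ∈ W →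
    ZFSet.sep (fun z => SatAB W ∅ ∅ φ (Fin.cons z v)) a ∈ W) ∧
  (∀ (n : ℕ) (φ : Fml (n + 2)) (v : Fin n → ZFSet.{0}), (∀ i, v i ∈ W) → ∀ a, a ∈ W →
    (∀ x, x ∈ a → ∃ y, y ∈ W ∧ SatAB W ∅ ∅ φ (Fin.cons x (Fin.cons y v))) →
    ∃ b, b ∈ W ∧ ∀ x, x ∈ a → ∃ y, y ∈ b ∧ SatAB W ∅ ∅ φ (Fin.cons x (Fin.cons y v))) ∧
  (∀ x, x ∈ W → (∀ y, y ∈ x → y ≠ ∅) →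
    ∃ c, c ∈ W ∧ ∀ y, y ∈ x → ∃! z, z ∈ y ∧ ZFSet.pair y z ∈ c)

/-- `W` is a transitive model of `ZFC` (with Power Set). -/
def ModelsZFC (W : Set ZFSet.{0}) : Prop :=
  ModelsZFCminus W ∧ ∀ x, x ∈ W → ∃ p, p ∈ W ∧ ∀ z, z ∈ W → (z ∈ p ↔ z ⊆ x)

/-- `W` is a model of `Z₂ = ZFC⁻ +` "every set is countable". -/
def ModelsZ2 (W : Set ZFSet.{0}) : Prop :=
  ModelsZFCminus W ∧ ∀ x, x ∈ W → CtblIn W x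

/-- `p` is the power set of `x` as computed in `W`. -/
def IsPowIn (W : Set ZFSet.{0}) (x p : ZFSet.{0}) : Prop :=
  p ∈ W ∧ ∀ z, z ∈ W → (z ∈ p ↔ z ⊆ x)

/-- `W` is a model of `Z₃ = ZFC⁻ + 𝒫(ω)` exists `+` every set has size `≤ ℶ₁`. -/
def ModelsZ3 (W : Set ZFSet.{0}) : Prop :=
  ModelsZFCminus W ∧ (∃ p, IsPowIn W ZFSet.omega p) ∧
    ∀ x, x ∈ W → ∀ p, IsPowIn W ZFSet.omega p → ∃ f, f ∈ W ∧ IsInjF x p f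

/-- `W` is a model of `Z₄ = ZFC⁻ + 𝒫(𝒫(ω))` exists `+` every set has size `≤ ℶ₂`. -/
def ModelsZ4 (W : Set ZFSet.{0}) : Prop :=
  ModelsZFCminus W ∧
    (∃ p q, IsPowIn W ZFSet.omega p ∧ IsPowIn W p q) ∧
    ∀ x, x ∈ W → ∀ p q, IsPowIn W ZFSet.omega p → IsPowIn W p q →
      ∃ f, f ∈ W ∧ IsInjF x q f

/-! ### Forcing: the Lévy collapse, genericity, generic extensions -/

/-- The Lévy collapse `Col(ω, <κ)`: finite partial functions `p` with
`p(α, n) ∈ α` for `α < κ`, `n < ω`. -/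
def ColLt (κ : ZFSet.{0}) : ZFSet.{0} :=
  ZFSet.sep (fun p => p.toSet.Finite ∧
      (∀ z, z ∈ p → ∃ α n β, α ∈ κ ∧ n ∈ ZFSet.omega ∧ β ∈ α ∧
        z = ZFSet.pair (ZFSet.pair α n) β) ∧
      (∀ α n β β', ZFSet.pair (ZFSet.pair α n) β ∈ p →
        ZFSet.pair (ZFSet.pair α n) β' ∈ p → β = β'))
    (ZFSet.powerset (prodZ (prodZ κ ZFSet.omega) (ZFSet.sUnion κ)))

/-- `G` is a filter on the partial order `P` of partial functions ordered by
reverse inclusion (`p` is stronger than `q` iff `q ⊆ p`) which meets every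
dense subset of `P` lying in the (transitive) model `W`. -/
def GenericOver (W : Set ZFSet.{0}) (P G : ZFSet.{0}) : Prop :=
  G ⊆ P ∧
  (∀ p q, p ∈ G → q ∈ P → q ⊆ p → q ∈ G) ∧
  (∀ p q, p ∈ G → q ∈ G → ∃ r, r ∈ G ∧ p ⊆ r ∧ q ⊆ r) ∧
  (∀ D, D ∈ W → D ⊆ P → (∀ p, p ∈ P → ∃ q, q ∈ D ∧ p ⊆ q) → ∃ q, q ∈ G ∧ q ∈ D)

/-- Genericity for an abstract partial order `R` (a set of pairs) on `P`:
`pair p q ∈ R` means `p` is stronger than (extends) `q`. -/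
def GenericOnP (W : Set ZFSet.{0}) (P R G : ZFSet.{0}) : Prop :=
  G ⊆ P ∧
  (∀ p q, p ∈ G → q ∈ P → ZFSet.pair p q ∈ R → q ∈ G) ∧
  (∀ p q, p ∈ G → q ∈ G → ∃ r, r ∈ G ∧ ZFSet.pair r p ∈ R ∧ ZFSet.pair r q ∈ R) ∧
  (∀ D, D ∈ W → D ⊆ P → (∀ p, p ∈ P → ∃ q, q ∈ D ∧ ZFSet.pair q p ∈ R) →
    ∃ q, q ∈ G ∧ q ∈ D)

/-- Evaluation of a forcing name `τ` by a filter `G`: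
`nameVal G τ = {nameVal G σ | ∃ p ∈ G, (σ, p) ∈ τ}`. -/
def nameVal (G : ZFSet.{0}) : ZFSet.{0} → ZFSet.{0} :=
  (ZFSet.mem_wf.transGen).fix (C := fun _ => ZFSet.{0}) fun τ ih =>
    img (fun σ => if h : Relation.TransGen (· ∈ ·) σ τ then ih σ h else ∅)
      (ZFSet.sep (fun σ => ∃ p, p ∈ G ∧ ZFSet.pair σ p ∈ τ)
        (ZFSet.sUnion (ZFSet.sUnion τ)))

/-- The generic extension `M[G]` of a transitive set model `M`, via names. -/
def extSet (M G : ZFSet.{0}) : Set ZFSet.{0} := {x | ∃ τ, τ ∈ M ∧ x = nameVal G τ}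

/-! ### Remarkable cardinals (Schindler), relative to a ground model class -/

/-- Clubs of countable subsets of `S`, as computed in the (transitive) model
`E`: the club is coded by a set `D ∈ E`, its members are subsets of `S`
countably infinite in `E`, it is cofinal among such sets lying in `E`, and it
is closed under unions of increasing `ω`-chains coded in `E`. -/
def ClubSubIn (E : Set ZFSet.{0}) (S : Set ZFSet.{0}) (D : ZFSet.{0}) : Prop :=
  D ∈ E ∧
  (∀ X, X ∈ D → X.toSet ⊆ S ∧ CtblInfIn E X) ∧
  (∀ X : ZFSet.{0}, X ∈ E → X.toSet ⊆ S → CtblInfIn E X → ∃ Y, Y ∈ D ∧ X ⊆ Y) ∧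
  (∀ g, g ∈ E → ZFSet.IsFunc ZFSet.omega D g →
    (∀ n y y', n ∈ ZFSet.omega → ZFSet.pair n y ∈ g →
      ZFSet.pair (insert n n) y' ∈ g → y ⊆ y') →
    ZFSet.sUnion (imageOf g) ∈ D)

/-- Stationarity of a collection `C` of countable subsets of `S`, as computed
in the model `E`. -/
def StatSubIn (E : Set ZFSet.{0}) (S : Set ZFSet.{0}) (C : Set ZFSet.{0}) : Prop :=
  ∀ D : ZFSet.{0}, ClubSubIn E S D → ∃ X, X ∈ C ∧ X ∈ D

/-- `X` condenses remarkably (with ground model `W`, extension operation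
`Ext` sending a generic object to the corresponding extension of `W`,
collapse height `δ`, target `θ`, and generic `G`):  `X = ran(π)` for some
elementary `π : (H_β^{W[G∩H_α^W]}, ∈, H_β^W, G∩H_α^W) → (H_θ^{W[G]}, ∈, H_θ^W, G)`
with `α = crit(π) < β < δ` and `β` a cardinal of `W`. -/
def CondensesRemarkably (W : Set ZFSet.{0}) (Ext : ZFSet.{0} → Set ZFSet.{0})
    (δ θ G X : ZFSet.{0}) : Prop :=
  ∃ (f : ZFSet.{0} → ZFSet.{0}) (α β : ZFSet.{0}), IsOrd α ∧ α ∈ β ∧ β ∈ δ ∧ CardIn W β ∧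
    (∀ ξ, ξ ∈ α → f ξ = ξ) ∧ f α ≠ α ∧
    (let Gα : ZFSet.{0} := ZFSet.sep (fun p => p ∈ HsetIn W α) G
     let Dom : Set ZFSet.{0} := HsetIn (Ext Gα) β
     let Cod : Set ZFSet.{0} := HsetIn (Ext G) θ
     Set.MapsTo f Dom Cod ∧ X.toSet = f '' Dom ∧
     ∀ (n : ℕ) (φ : Fml n) (v : Fin n → ZFSet.{0}), (∀ i, v i ∈ Dom) →
       (SatAB Dom W Gα.toSet φ v ↔ SatAB Cod W G.toSet φ (f ∘ v)))

/-- `δ` is `θ`-remarkable, in the sense of the (transitive) ground model `W`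
with extensions given by `Ext`: for every `G` which is `Col(ω, <δ)`-generic
over `W`, in `W[G]` the set of countable `X ⊆ H_θ^{W[G]}` which condense
remarkably is stationary. -/
def ThetaRemarkableVia (W : Set ZFSet.{0}) (Ext : ZFSet.{0} → Set ZFSet.{0})
    (δ θ : ZFSet.{0}) : Prop :=
  ∀ G, GenericOver W (ColLt δ) G →
    StatSubIn (Ext G) (HsetIn (Ext G) θ)
      {X | CondensesRemarkably W Ext δ θ G X}

/-- `δ` is remarkable in the sense of `(W, Ext)`:  `θ`-remarkable for every
regular (in `W`) `θ > δ`. -/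
def RemarkableVia (W : Set ZFSet.{0}) (Ext : ZFSet.{0} → Set ZFSet.{0}) (δ : ZFSet.{0}) : Prop :=
  ∀ θ, RegularIn W θ → δ ∈ θ → ThetaRemarkableVia W Ext δ θ

/-! ### Indiscernibles and sharps -/

/-- `I` is a set (or class) of ordinal indiscernibles for the structure
`(S, ∈, A)`. -/
def IndiscFor (S A : Set ZFSet.{0}) (I : Set ZFSet.{0}) : Prop :=
  (∀ x ∈ I, IsOrd x ∧ x ∈ S) ∧
  ∀ (n : ℕ) (φ : Fml n) (v w : Fin n → ZFSet.{0}),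
    (∀ i, v i ∈ I) → (∀ i, w i ∈ I) →
    (∀ i j : Fin n, i < j → v i ∈ v j) → (∀ i j : Fin n, i < j → w i ∈ w j) →
    (SatAB S A ∅ φ v ↔ SatAB S A ∅ φ w)

/-- `0♯` exists: for some uncountable limit ordinal `λ`, `L_λ` has an
uncountable set of indiscernibles. -/
def ZeroSharpExists : Prop :=
  ∃ lam : ZFSet.{0}, IsLimitOrd lam ∧ ¬ lam.toSet.Countable ∧
    ∃ I : ZFSet.{0}, ¬ I.toSet.Countable ∧ IndiscFor (Lstage lam).toSet ∅ I.toSet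

/-- The sharp of `L[A]` exists: for some uncountable limit ordinal `λ`, the
structure `(L_λ[A], ∈, A)` has an uncountable set of indiscernibles. -/
def SharpOverExists (A : ZFSet.{0}) : Prop :=
  ∃ lam : ZFSet.{0}, IsLimitOrd lam ∧ ¬ lam.toSet.Countable ∧
    ∃ I : ZFSet.{0}, ¬ I.toSet.Countable ∧
      IndiscFor (LstageA A.toSet lam).toSet A.toSet I.toSet

/-- `I` is a closed unbounded proper class of ordinals. -/
def ProperClassClub (I : Set ZFSet.{0}) : Prop :=
  (∀ x ∈ I, IsOrd x) ∧
  (∀ α, IsOrd α → ∃ β, IsOrd β ∧ α ∈ β ∧ β ∈ I) ∧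
  (∀ α, IsOrd α → α ≠ ∅ → (∀ β ∈ α, ∃ θ, θ ∈ I ∧ θ ∈ α ∧ (β ∈ θ ∨ β = θ)) → α ∈ I)

/-- `s` is (a real coding) `0♯`: there is a closed unbounded proper class `I`
of Silver indiscernibles for `L` and `s` is the set of codes of formulas
satisfied in `L` by increasing tuples from `I`. -/
def IsZeroSharpReal (s : ZFSet.{0}) : Prop :=
  s ⊆ ZFSet.omega ∧
  ∃ I : Set ZFSet.{0}, ProperClassClub I ∧ IndiscFor LClass ∅ I ∧
    s = ZFSet.sep (fun m => ∃ (n : ℕ) (φ : Fml n) (v : Fin n → ZFSet.{0}),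
          (∀ i, v i ∈ I) ∧ (∀ i j : Fin n, i < j → v i ∈ v j) ∧
          Sat LClass φ v ∧ m = natZ (Nat.pair n (codeF φ))) ZFSet.omega

/-! ### Admissible ordinals and Harrington's Principle -/

/-- The (graph of the) function `f` is `Σ₁`-definable with parameters over the
structure `(S, ∈)`. -/
def Sigma1DefOver (S : Set ZFSet.{0}) (f : ZFSet.{0} → ZFSet.{0}) : Prop :=
  ∃ (n : ℕ) (ψ : Fml (n + 3)), IsDelta0 ψ ∧
    ∃ p : Fin n → ZFSet.{0}, (∀ i, p i ∈ S) ∧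
      ∀ a b, a ∈ S → b ∈ S →
        (f a = b ↔ Sat S (Fml.ex ψ) (Fin.cons a (Fin.cons b p)))

/-- `α` is `x`-admissible: `α > ω` is a limit ordinal and no
`Σ₁(L_α[x])`-definable function maps some `δ < α` cofinally into `α`. -/
def Admissible (x α : ZFSet.{0}) : Prop :=
  IsLimitOrd α ∧ ZFSet.omega ∈ α ∧
  ¬ ∃ δ, δ ∈ α ∧ ∃ f : ZFSet.{0} → ZFSet.{0},
      Sigma1DefOver (LstageA x.toSet α).toSet f ∧
      (∀ β, β ∈ δ → f β ∈ α) ∧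
      ∀ ξ, ξ ∈ α → ∃ β, β ∈ δ ∧ (ξ ∈ f β ∨ ξ = f β)

/-- The generalized Harrington Principle `HP(M)` for the inner model given by
the class `W`: there is a real `x` such that every `x`-admissible ordinal is a
cardinal of `W`. -/
def HPclass (W : Set ZFSet.{0}) : Prop :=
  ∃ x : ZFSet.{0}, x ⊆ ZFSet.omega ∧ ∀ α, Admissible x α → CardIn W α

/-- Harrington's Principle `HP(L)`. -/
def HPL : Prop := HPclass LClass

/-- `HP(L)` as computed inside the (transitive) model `W`. -/
def HPLIn (W : Set ZFSet.{0}) : Prop :=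
  ∃ x, x ∈ W ∧ x ⊆ ZFSet.omega ∧
    ∀ α, α ∈ W → Admissible x α → CardIn (LClassIn W) α

/-! ### Inner models, elementary embeddings, rigidity, covering -/

/-- `W` is an inner model: a transitive proper class containing all ordinals
and satisfying ZFC. -/
def InnerModelClass (W : Set ZFSet.{0}) : Prop :=
  (∀ x, x ∈ W → x.toSet ⊆ W) ∧ (∀ α : ZFSet.{0}, IsOrd α → α ∈ W) ∧ ModelsZFC W

/-- `j` is an elementary embedding of the class `(W, ∈)` into itself. -/
def ElemEmbOn (W : Set ZFSet.{0}) (j : ZFSet.{0} → ZFSet.{0}) : Prop :=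
  Set.MapsTo j W W ∧
  ∀ (n : ℕ) (φ : Fml n) (v : Fin n → ZFSet.{0}),
    (∀ i, v i ∈ W) → (Sat W φ v ↔ Sat W φ (j ∘ v))

/-- `W` has the rigidity property: there is no nontrivial elementary embedding
from `W` to `W`. -/
def RigidClass (W : Set ZFSet.{0}) : Prop :=
  ¬ ∃ j : ZFSet.{0} → ZFSet.{0}, ElemEmbOn W j ∧ ∃ x, x ∈ W ∧ j x ≠ x

/-- `W` has the full covering property: every set `X` of ordinals is covered
by some `Y ∈ W` with `|Y| = |X| + ω₁`. -/
def FullCovering (W : Set ZFSet.{0}) : Prop :=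
  ∀ X : ZFSet.{0}, (∀ z ∈ X, IsOrd z) →
    ∃ Y, Y ∈ W ∧ X ⊆ Y ∧ Nonempty (Y.toSet ≃ (X.toSet ⊕ (Aleph 1).toSet))

/-- The restriction `M|θ` of the inner model `W`: its elements of rank `< θ`. -/
def restrictTo (W : Set ZFSet.{0}) (θ : ZFSet.{0}) : Set ZFSet.{0} :=
  {x | x ∈ W ∧ rankZ x ∈ θ}

/-- The class `S` is definable (with parameters) in `H_θ`. -/
def DefinableInH (θ : ZFSet.{0}) (S : Set ZFSet.{0}) : Prop :=
  ∃ (n : ℕ) (φ : Fml (n + 1)) (v : Fin n → ZFSet.{0}),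
    (∀ i, v i ∈ Hset θ) ∧ ∀ x, x ∈ Hset θ → (x ∈ S ↔ Sat (Hset θ) φ (Fin.cons x v))

/-- `ν` is weakly inaccessible in `W`: a regular limit cardinal of `W`. -/
def WeaklyInaccIn (W : Set ZFSet.{0}) (ν : ZFSet.{0}) : Prop :=
  RegularIn W ν ∧ ZFSet.omega ∈ ν ∧
    ∀ β, β ∈ ν → ∃ δ, δ ∈ ν ∧ β ∈ δ ∧ CardIn W δ

/-! ### Measures, `κ`-models and `0†` -/

/-- `⟨L[U], ∈, U⟩ ⊨ "U is a normal ultrafilter over κ"`:  `L[U]` is a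
`κ`-model. -/
def IsKappaModel (κ U : ZFSet.{0}) : Prop :=
  IsOrd κ ∧ ZFSet.omega ∈ κ ∧ U ∈ LrelClass U ∧
  (∀ X, X ∈ U → X ⊆ κ ∧ X ∈ LrelClass U) ∧ κ ∈ U ∧ (∅ : ZFSet.{0}) ∉ U ∧
  (∀ X Y, X ∈ U → Y ∈ U → X ∩ Y ∈ U) ∧
  (∀ X Y, X ∈ U → Y ∈ LrelClass U → X ⊆ Y → Y ⊆ κ → Y ∈ U) ∧
  (∀ X, X ∈ LrelClass U → X ⊆ κ → (X ∈ U ∨ κ \ X ∈ U)) ∧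
  (∀ α, α ∈ κ → (insert α ∅ : ZFSet.{0}) ∉ U) ∧
  (∀ δ g, δ ∈ κ → g ∈ LrelClass U → ZFSet.IsFunc δ (ZFSet.powerset κ) g →
    (∀ ξ y, ZFSet.pair ξ y ∈ g → y ∈ U) →
    ZFSet.sep (fun β => ∀ ξ, ξ ∈ δ → ∀ y, ZFSet.pair ξ y ∈ g → β ∈ y) κ ∈ U) ∧
  (∀ f X, f ∈ LrelClass U → X ∈ U → ZFSet.IsFunc κ κ f →
    (∀ α, α ∈ X → α ≠ ∅ → ∀ y, ZFSet.pair α y ∈ f → y ∈ α) →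
    ∃ β Y, β ∈ κ ∧ Y ∈ U ∧ ∀ α, α ∈ Y → ZFSet.pair α β ∈ f)

/-- `0†` exists: there is a `κ`-model (for some `κ`) and a nontrivial
elementary embedding from that model to itself with critical point
greater than `κ`. -/
def ZeroDaggerExists : Prop :=
  ∃ κ U : ZFSet.{0}, IsKappaModel κ U ∧
    ∃ j : ZFSet.{0} → ZFSet.{0}, ElemEmbOn (LrelClass U) j ∧
      ∃ η, IsOrd η ∧ κ ∈ η ∧ (∀ β, β ∈ η → j β = β) ∧ j η ≠ η

/-- `U` witnesses that `κ` is a measurable cardinal (in `V`): `U` is a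
`κ`-complete nonprincipal normal ultrafilter on `κ`. -/
def IsMeasureOn (κ U : ZFSet.{0}) : Prop :=
  IsOrd κ ∧ ZFSet.omega ∈ κ ∧
  (∀ X, X ∈ U → X ⊆ κ) ∧ κ ∈ U ∧ (∅ : ZFSet.{0}) ∉ U ∧
  (∀ X Y, X ∈ U → Y ∈ U → X ∩ Y ∈ U) ∧
  (∀ X Y, X ∈ U → X ⊆ Y → Y ⊆ κ → Y ∈ U) ∧
  (∀ X : ZFSet.{0}, X ⊆ κ → (X ∈ U ∨ κ \ X ∈ U)) ∧
  (∀ α, α ∈ κ → (insert α ∅ : ZFSet.{0}) ∉ U) ∧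
  (∀ x : ZFSet.{0}, x.toSet ⊆ U.toSet → CardLT x κ → x ≠ ∅ →
    ZFSet.sep (fun β => ∀ y, y ∈ x → β ∈ y) κ ∈ U) ∧
  (∀ f X, X ∈ U → ZFSet.IsFunc κ κ f →
    (∀ α, α ∈ X → α ≠ ∅ → ∀ y, ZFSet.pair α y ∈ f → y ∈ α) →
    ∃ β Y, β ∈ κ ∧ Y ∈ U ∧ ∀ α, α ∈ Y → ZFSet.pair α β ∈ f)

/-- `κ` is a measurable cardinal. -/
def IsMeasurable (κ : ZFSet.{0}) : Prop := ∃ U, IsMeasureOn κ U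

/-- `U ∈ W` witnesses measurability of `κ` inside the inner model `W`. -/
def MeasurableIn (W : Set ZFSet.{0}) (κ U : ZFSet.{0}) : Prop :=
  U ∈ W ∧ IsOrd κ ∧ ZFSet.omega ∈ κ ∧
  (∀ X, X ∈ U → X ⊆ κ) ∧ κ ∈ U ∧ (∅ : ZFSet.{0}) ∉ U ∧
  (∀ X Y, X ∈ U → Y ∈ U → X ∩ Y ∈ U) ∧
  (∀ X Y, X ∈ U → Y ∈ W → X ⊆ Y → Y ⊆ κ → Y ∈ U) ∧
  (∀ X, X ∈ W → X ⊆ κ → (X ∈ U ∨ κ \ X ∈ U)) ∧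
  (∀ α, α ∈ κ → (insert α ∅ : ZFSet.{0}) ∉ U) ∧
  (∀ δ g, δ ∈ κ → g ∈ W → ZFSet.IsFunc δ (ZFSet.powerset κ) g →
    (∀ ξ y, ZFSet.pair ξ y ∈ g → y ∈ U) →
    ZFSet.sep (fun β => ∀ ξ, ξ ∈ δ → ∀ y, ZFSet.pair ξ y ∈ g → β ∈ y) κ ∈ U)

/-- There is an inner model with a measurable cardinal. -/
def ExistsInnerModelMeasurable : Prop :=
  ∃ W : Set ZFSet.{0}, InnerModelClass W ∧ ∃ κ U, MeasurableIn W κ U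

/-! ### Core-model-like inner models -/

/-- `W` satisfies the GCH. -/
def GCHIn (W : Set ZFSet.{0}) : Prop :=
  ∀ κ, CardIn W κ → (ZFSet.omega ∈ κ ∨ ZFSet.omega = κ) →
    ∃ f, f ∈ W ∧ IsInjF (ZFSet.sep (fun z => z ∈ W) (ZFSet.powerset κ))
      (SuccCardIn W κ) f

/-- `W` has the condensation property: the transitive collapse of any
elementary submodel of an initial segment of `W` is again an initial segment
of `W`. -/
def CondensationFor (W : Set ZFSet.{0}) : Prop :=
  ∀ θ : ZFSet.{0}, IsOrd θ → ∀ X : ZFSet.{0},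
    X.toSet ⊆ restrictTo W θ → ElemSub X (restrictTo W θ) →
    ∃ θ', IsOrd θ' ∧ (collapseSet X).toSet = restrictTo W θ'

/-- The properties of the Dodd–Jensen core model `K` (below a measurable
cardinal) which are relevant here: `K` is an inner model satisfying the GCH,
with condensation, and (by Dodd–Jensen, given that there is no inner model
with a measurable) the rigidity property. -/
def CoreModelProps (W : Set ZFSet.{0}) : Prop :=
  InnerModelClass W ∧ GCHIn W ∧ CondensationFor W ∧ RigidClass W

/-! ### `L(ℝ)`, determinacy, and `HOD` -/

/-- The base of the `L(ℝ)` hierarchy: the transitive closure of `{𝒫(ω)}`. -/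
def lrBase : ZFSet.{0} :=
  insert (ZFSet.powerset ZFSet.omega) (tcl (ZFSet.powerset ZFSet.omega))

/-- The hierarchy `L_α(ℝ)`. -/
def LRstage : ZFSet.{0} → ZFSet.{0} :=
  ZFSet.mem_wf.fix (C := fun _ => ZFSet.{0}) fun α ih =>
    lrBase ∪ ZFSet.sUnion
      (img (fun β => if h : β ∈ α then DefSetA ∅ (ih β h) else ∅) α)

/-- The class `L(ℝ)`. -/
def LRClass : Set ZFSet.{0} := {x | ∃ α, IsOrd α ∧ x ∈ LRstage α}

/-- The `ZFSet` coding the function `ω → ω` given by `g`. -/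
def seqCode (g : ℕ → ℕ) : ZFSet.{0} :=
  img (fun m => ZFSet.pair m (natZ (g (zfToNat m)))) ZFSet.omega

/-- The game on `ω` with payoff `A` (a set of coded functions `ω → ω`) is
determined: one of the two players has a winning strategy. -/
def DeterminedZ (A : ZFSet.{0}) : Prop :=
  (∃ σ : List ℕ → ℕ, ∀ g : ℕ → ℕ,
    (∀ n : ℕ, g (2 * n) = σ (List.ofFn (fun i : Fin (2 * n) => g i.val))) →
    seqCode g ∈ A) ∨
  (∃ τ : List ℕ → ℕ, ∀ g : ℕ → ℕ,
    (∀ n : ℕ, g (2 * n + 1) = τ (List.ofFn (fun i : Fin (2 * n + 1) => g i.val))) →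
    seqCode g ∉ A)

/-- `AD^{L(ℝ)}`: every set of reals in `L(ℝ)` is determined.  (Since every
real, and every strategy, belongs to `L(ℝ)`, this is equivalent to `L(ℝ) ⊨ AD`.) -/
def ADinLR : Prop :=
  ∀ A, A ∈ LRClass → (∀ f, f ∈ A → ZFSet.IsFunc ZFSet.omega ZFSet.omega f) →
    DeterminedZ A

/-- `x` is ordinal definable. -/
def IsOD (x : ZFSet.{0}) : Prop :=
  ∃ (n : ℕ) (φ : Fml (n + 1)) (v : Fin n → ZFSet.{0}),
    (∀ i, IsOrd (v i)) ∧ ∀ y, (Sat Set.univ φ (Fin.cons y v) ↔ y = x)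

/-- The class `HOD` of hereditarily ordinal definable sets. -/
def HODClass : Set ZFSet.{0} :=
  {x | IsOD x ∧ ∀ y, y ∈ tcl x → IsOD y}

/-- The class `L[A]` as computed inside the (transitive) model `W`. -/
def LrelClassIn (W : Set ZFSet.{0}) (A : ZFSet.{0}) : Set ZFSet.{0} :=
  {x | ∃ α, IsOrd α ∧ α ∈ W ∧ x ∈ LstageA A.toSet α}

/-! ### Definable relations and functions -/

/-- Renaming of the free variables of a formula. -/
def Fml.rename : ∀ {n m : ℕ}, (Fin n → Fin m) → Fml n → Fml m
  | _, _, ρ, .mem i j => .mem (ρ i) (ρ j)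
  | _, _, ρ, .eq i j => .eq (ρ i) (ρ j)
  | _, _, ρ, .inA i => .inA (ρ i)
  | _, _, ρ, .inB i => .inB (ρ i)
  | _, _, ρ, .not φ => .not (φ.rename ρ)
  | _, _, ρ, .and φ ψ => .and (φ.rename ρ) (ψ.rename ρ)
  | _, _, ρ, .ex φ => .ex (φ.rename (Fin.cons 0 (fun i => (ρ i).succ)))

theorem SatAB_rename (S A B : Set ZFSet.{0}) {n : ℕ} (φ : Fml n) :
    ∀ {m : ℕ} (ρ : Fin n → Fin m) (v : Fin m → ZFSet.{0}),
      SatAB S A B (φ.rename ρ) v ↔ SatAB S A B φ (fun i => v (ρ i)) := by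
  induction φ with
  | mem i j => intros; rfl
  | eq i j => intros; rfl
  | inA i => intros; rfl
  | inB i => intros; rfl
  | not φ ih => intro m ρ v; simp only [Fml.rename, SatAB, ih]
  | and φ ψ ih₁ ih₂ => intro m ρ v; simp only [Fml.rename, SatAB, ih₁, ih₂]
  | ex φ ih =>
    intro m ρ v
    simp only [Fml.rename, SatAB, ih]
    refine exists_congr fun x => and_congr_right fun _ => ?_
    have : (fun i => (Fin.cons x v : Fin (m + 1) → ZFSet.{0})
        ((Fin.cons 0 (fun i => (ρ i).succ) : Fin _ → Fin (m + 1)) i)) =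
        Fin.cons x (fun i => v (ρ i)) := by
      funext i
      refine Fin.cases ?_ (fun i => ?_) i <;> simp
    rw [this]

/-- A relation on sets is definable if it is defined over `V` by a formula. -/
class Dfn {n : ℕ} (P : (Fin n → ZFSet.{0}) → Prop) : Prop where
  out : ∃ φ : Fml n, ∀ v, Sat Set.univ φ v ↔ P v

/-- A function on sets is definable if its graph is. -/
class DF {n : ℕ} (f : (Fin n → ZFSet.{0}) → ZFSet.{0}) : Prop where
  out : Dfn (fun w : Fin (n + 1) → ZFSet.{0} => w 0 = f (fun i => w i.succ))

theorem Dfn.congr {n : ℕ} {P Q : (Fin n → ZFSet.{0}) → Prop} (hP : Dfn P)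
    (h : ∀ v, P v ↔ Q v) : Dfn Q := by
  obtain ⟨φ, hφ⟩ := hP
  exact ⟨φ, fun v => (hφ v).trans (h v)⟩

theorem Dfn.rename {n m : ℕ} {P : (Fin n → ZFSet.{0}) → Prop} (hP : Dfn P)
    (ρ : Fin n → Fin m) : Dfn (fun v => P (fun i => v (ρ i))) := by
  obtain ⟨φ, hφ⟩ := hP
  exact ⟨φ.rename ρ, fun v => (SatAB_rename _ _ _ φ ρ v).trans (hφ _)⟩

theorem DF.rename {n m : ℕ} {f : (Fin n → ZFSet.{0}) → ZFSet.{0}} (hf : DF f)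
    (ρ : Fin n → Fin m) : DF (fun v => f (fun i => v (ρ i))) := by
  constructor
  exact (hf.out.rename (Fin.cons 0 (fun i => (ρ i).succ) : Fin (n + 1) → Fin (m + 1))).congr
    fun v => by simp

instance Dfn.instAnd {n : ℕ} (P Q : (Fin n → ZFSet.{0}) → Prop) [hP : Dfn P] [hQ : Dfn Q] :
    Dfn (fun v => P v ∧ Q v) := by
  obtain ⟨φ, hφ⟩ := hP
  obtain ⟨ψ, hψ⟩ := hQ
  exact ⟨.and φ ψ, fun v => and_congr (hφ v) (hψ v)⟩

instance Dfn.instNot {n : ℕ} (P : (Fin n → ZFSet.{0}) → Prop) [hP : Dfn P] :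
    Dfn (fun v => ¬ P v) := by
  obtain ⟨φ, hφ⟩ := hP
  exact ⟨.not φ, fun v => not_congr (hφ v)⟩

instance Dfn.instEx {n : ℕ} (P : (Fin n → ZFSet.{0}) → ZFSet.{0} → Prop)
    [hP : Dfn (fun w : Fin (n + 1) → ZFSet.{0} => P (fun i => w i.succ) (w 0))] :
    Dfn (fun v => ∃ x, P v x) := by
  obtain ⟨φ, hφ⟩ := hP
  refine ⟨.ex φ, fun v => ?_⟩
  have h : Sat Set.univ (.ex φ) v ↔ ∃ x, Sat Set.univ φ (Fin.cons x v) := by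
    simp [Sat, SatAB]
  rw [h]
  refine exists_congr fun x => ?_
  simp [hφ]

instance Dfn.instOr {n : ℕ} (P Q : (Fin n → ZFSet.{0}) → Prop) [Dfn P] [Dfn Q] :
    Dfn (fun v => P v ∨ Q v) :=
  Dfn.congr (P := fun v => ¬ (¬ P v ∧ ¬ Q v)) inferInstance fun v => by tauto

instance Dfn.instImp {n : ℕ} (P Q : (Fin n → ZFSet.{0}) → Prop) [Dfn P] [Dfn Q] :
    Dfn (fun v => P v → Q v) :=
  Dfn.congr (P := fun v => ¬ (P v ∧ ¬ Q v)) inferInstance fun v => by tauto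

instance Dfn.instIff {n : ℕ} (P Q : (Fin n → ZFSet.{0}) → Prop) [Dfn P] [Dfn Q] :
    Dfn (fun v => P v ↔ Q v) :=
  Dfn.congr (P := fun v => (P v → Q v) ∧ (Q v → P v)) inferInstance fun v => by tauto

instance Dfn.instAll {n : ℕ} (P : (Fin n → ZFSet.{0}) → ZFSet.{0} → Prop)
    [hP : Dfn (fun w : Fin (n + 1) → ZFSet.{0} => P (fun i => w i.succ) (w 0))] :
    Dfn (fun v => ∀ x, P v x) :=
  Dfn.congr (P := fun v => ¬ ∃ x, ¬ P v x) inferInstance fun v => by simp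

instance DF.instVar {n : ℕ} (i : Fin n) : DF (fun v => v i) :=
  ⟨⟨.eq 0 i.succ, fun _ => Iff.rfl⟩⟩

/-- Substitution of definable functions into a definable relation of one variable. -/
theorem Dfn.subst₁ {n : ℕ} {R : (Fin n → ZFSet.{0}) → ZFSet.{0} → Prop}
    {a : (Fin n → ZFSet.{0}) → ZFSet.{0}}
    (hR : Dfn (fun w : Fin (n + 1) → ZFSet.{0} => R (fun i => w i.succ) (w 0))) (ha : DF a) :
    Dfn (fun v => R v (a v)) := by
  have := ha.out
  exact Dfn.congr (P := fun v => ∃ x, x = a v ∧ R v x) inferInstance fun v => by simp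

instance Dfn.instEq {n : ℕ} (a b : (Fin n → ZFSet.{0}) → ZFSet.{0}) [ha : DF a] [hb : DF b] :
    Dfn (fun v => a v = b v) := by
  refine Dfn.subst₁ (R := fun v x => x = b v) hb.out ha

instance Dfn.instMem {n : ℕ} (a b : (Fin n → ZFSet.{0}) → ZFSet.{0}) [ha : DF a] [hb : DF b] :
    Dfn (fun v => a v ∈ b v) := by
  refine Dfn.subst₁ (R := fun v x => x ∈ b v) ?_ ha
  refine Dfn.subst₁ (R := fun w y => w 0 ∈ y) ?_ (hb.rename Fin.succ)
  exact ⟨.mem 1 0, fun _ => Iff.rfl⟩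

instance Dfn.instSubset {n : ℕ} (a b : (Fin n → ZFSet.{0}) → ZFSet.{0}) [ha : DF a]
    [hb : DF b] : Dfn (fun v => a v ⊆ b v) := by
  have := ha.rename Fin.succ
  have := hb.rename Fin.succ
  exact Dfn.congr (P := fun v => ∀ x, x ∈ a v → x ∈ b v) inferInstance fun v => Iff.rfl

theorem Dfn.subst_aux {k : ℕ} {R : (Fin k → ZFSet.{0}) → Prop} (hR : Dfn R) (j : ℕ) :
    ∀ {n : ℕ} (t : Fin k → (Fin n → ZFSet.{0}) → ZFSet.{0}), (∀ i, DF (t i)) →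
      (∀ i : Fin k, j ≤ i → ∃ m, t i = fun v => v m) → Dfn (fun v => R (fun i => t i v)) := by
  induction j with
  | zero =>
    intro n t _ ht
    choose ρ hρ using fun i => ht i (Nat.zero_le _)
    exact (hR.rename ρ).congr fun v => by simp [hρ]
  | succ j ih =>
    intro n t hd ht
    by_cases hj : j < k
    · have := hd ⟨j, hj⟩
      have h := ih (n := n + 1)
        (fun i => if i = ⟨j, hj⟩ then fun w => w 0 else fun w => t i (fun l => w l.succ))
        (fun i => by
          by_cases hi : i = ⟨j, hj⟩
          · simp only [hi, if_true]; infer_instance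
          · simp only [hi, if_false]; exact (hd i).rename Fin.succ)
        (fun i hi => by
          by_cases hij : i = ⟨j, hj⟩
          · exact ⟨0, by simp [hij]⟩
          · have : j ≠ i := fun h => hij (Fin.ext h.symm)
            obtain ⟨m, hm⟩ := ht i (by omega)
            exact ⟨m.succ, by simp [hij, hm]⟩)
      refine Dfn.congr (Dfn.subst₁
        (R := fun v x => R (fun i => if i = ⟨j, hj⟩ then x else t i v)) (h.congr fun w => ?_) this)
        fun v => ?_
      · refine iff_of_eq (congrArg R (funext fun i => ?_))
        split <;> rfl
      · refine iff_of_eq (congrArg R (funext fun i => ?_))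
        split
        · next h => rw [h]
        · rfl
    · exact ih t hd fun i hi => absurd i.2 (by omega)

theorem Dfn.subst {n k : ℕ} {R : (Fin k → ZFSet.{0}) → Prop} (hR : Dfn R)
    (t : Fin k → (Fin n → ZFSet.{0}) → ZFSet.{0}) (ht : ∀ i, DF (t i)) :
    Dfn (fun v => R (fun i => t i v)) :=
  hR.subst_aux k t ht fun i hi => absurd i.2 (by omega)

theorem DF.subst {n k : ℕ} {f : (Fin k → ZFSet.{0}) → ZFSet.{0}} (hf : DF f)
    (t : Fin k → (Fin n → ZFSet.{0}) → ZFSet.{0}) (ht : ∀ i, DF (t i)) :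
    DF (fun v => f (fun i => t i v)) := by
  constructor
  refine (hf.out.subst (n := n + 1)
    (Fin.cons (fun w => w 0) (fun i w => t i (fun l => w l.succ))) ?_).congr fun w => ?_
  · intro i
    refine Fin.cases ?_ (fun i => ?_) i
    · exact DF.instVar 0
    · exact (ht i).rename Fin.succ
  · simp

section Subst
variable {n : ℕ} {a b c d e f : (Fin n → ZFSet.{0}) → ZFSet.{0}}

theorem Dfn.comp₃ {R : ZFSet.{0} → ZFSet.{0} → ZFSet.{0} → Prop}
    (hR : Dfn (fun v : Fin 3 → ZFSet.{0} => R (v 0) (v 1) (v 2)))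
    (ha : DF a) (hb : DF b) (hc : DF c) : Dfn (fun v => R (a v) (b v) (c v)) :=
  hR.subst ![a, b, c] (by simp [Fin.forall_fin_succ, *])

theorem Dfn.comp₄ {R : ZFSet.{0} → ZFSet.{0} → ZFSet.{0} → ZFSet.{0} → Prop}
    (hR : Dfn (fun v : Fin 4 → ZFSet.{0} => R (v 0) (v 1) (v 2) (v 3)))
    (ha : DF a) (hb : DF b) (hc : DF c) (hd : DF d) : Dfn (fun v => R (a v) (b v) (c v) (d v)) :=
  hR.subst ![a, b, c, d] (by simp [Fin.forall_fin_succ, *])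

theorem Dfn.comp₅
    {R : ZFSet.{0} → ZFSet.{0} → ZFSet.{0} → ZFSet.{0} → ZFSet.{0} → Prop}
    (hR : Dfn (fun v : Fin 5 → ZFSet.{0} => R (v 0) (v 1) (v 2) (v 3) (v 4)))
    (ha : DF a) (hb : DF b) (hc : DF c) (hd : DF d) (he : DF e) :
    Dfn (fun v => R (a v) (b v) (c v) (d v) (e v)) :=
  hR.subst ![a, b, c, d, e] (by simp [Fin.forall_fin_succ, *])

theorem Dfn.comp₆
    {R : ZFSet.{0} → ZFSet.{0} → ZFSet.{0} → ZFSet.{0} → ZFSet.{0} → ZFSet.{0} → Prop}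
    (hR : Dfn (fun v : Fin 6 → ZFSet.{0} => R (v 0) (v 1) (v 2) (v 3) (v 4) (v 5)))
    (ha : DF a) (hb : DF b) (hc : DF c) (hd : DF d) (he : DF e) (hf : DF f) :
    Dfn (fun v => R (a v) (b v) (c v) (d v) (e v) (f v)) :=
  hR.subst ![a, b, c, d, e, f] (by simp [Fin.forall_fin_succ, *])

theorem DF.comp₁ {f : ZFSet.{0} → ZFSet.{0}} (hf : DF (fun v : Fin 1 → ZFSet.{0} => f (v 0)))
    (ha : DF a) : DF (fun v => f (a v)) :=
  hf.subst ![a] (by simp [*])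

theorem DF.comp₂ {f : ZFSet.{0} → ZFSet.{0} → ZFSet.{0}}
    (hf : DF (fun v : Fin 2 → ZFSet.{0} => f (v 0) (v 1)))
    (ha : DF a) (hb : DF b) : DF (fun v => f (a v) (b v)) :=
  hf.subst ![a, b] (by simp [Fin.forall_fin_succ, *])

theorem DF.comp₃ {f : ZFSet.{0} → ZFSet.{0} → ZFSet.{0} → ZFSet.{0}}
    (hf : DF (fun v : Fin 3 → ZFSet.{0} => f (v 0) (v 1) (v 2)))
    (ha : DF a) (hb : DF b) (hc : DF c) : DF (fun v => f (a v) (b v) (c v)) :=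
  hf.subst ![a, b, c] (by simp [Fin.forall_fin_succ, *])

theorem DF.comp₄ {f : ZFSet.{0} → ZFSet.{0} → ZFSet.{0} → ZFSet.{0} → ZFSet.{0}}
    (hf : DF (fun v : Fin 4 → ZFSet.{0} => f (v 0) (v 1) (v 2) (v 3)))
    (ha : DF a) (hb : DF b) (hc : DF c) (hd : DF d) : DF (fun v => f (a v) (b v) (c v) (d v)) :=
  hf.subst ![a, b, c, d] (by simp [Fin.forall_fin_succ, *])

theorem DF.comp₅ {f : ZFSet.{0} → ZFSet.{0} → ZFSet.{0} → ZFSet.{0} → ZFSet.{0} → ZFSet.{0}}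
    (hf : DF (fun v : Fin 5 → ZFSet.{0} => f (v 0) (v 1) (v 2) (v 3) (v 4)))
    (ha : DF a) (hb : DF b) (hc : DF c) (hd : DF d) (he : DF e) :
    DF (fun v => f (a v) (b v) (c v) (d v) (e v)) :=
  hf.subst ![a, b, c, d, e] (by simp [Fin.forall_fin_succ, *])

end Subst

/-- A function is definable if membership in its values is. -/
theorem DF.of_mem {n : ℕ} {f : (Fin n → ZFSet.{0}) → ZFSet.{0}}
    (h : Dfn (fun w : Fin (n + 1) → ZFSet.{0} => w 0 ∈ f (fun i => w i.succ))) : DF f := by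
  constructor
  have : Dfn (fun w : Fin (n + 2) → ZFSet.{0} => w 0 ∈ f (fun i => w i.succ.succ)) :=
    (h.rename (Fin.cons 0 (fun i => i.succ.succ) : Fin (n + 1) → Fin (n + 2))).congr
      fun w => by simp
  exact Dfn.congr (P := fun w : Fin (n + 1) → ZFSet.{0} =>
    ∀ z, z ∈ w 0 ↔ z ∈ f (fun i => w i.succ)) (by infer_instance) fun w => ZFSet.ext_iff.symm

instance DF.instEmpty {n : ℕ} : DF (fun _ : Fin n → ZFSet.{0} => (∅ : ZFSet.{0})) :=
  .of_mem <| Dfn.congr (P := fun w => ¬ w 0 = w 0) (by infer_instance) fun w => by simp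

instance DF.instSep {n : ℕ} (P : (Fin n → ZFSet.{0}) → ZFSet.{0} → Prop)
    (a : (Fin n → ZFSet.{0}) → ZFSet.{0})
    [hP : Dfn (fun w : Fin (n + 1) → ZFSet.{0} => P (fun i => w i.succ) (w 0))] [ha : DF a] :
    DF (fun v => ZFSet.sep (fun z => P v z) (a v)) := by
  have := ha.rename Fin.succ
  exact .of_mem <| Dfn.congr
    (P := fun w => w 0 ∈ a (fun i => w i.succ) ∧ P (fun i => w i.succ) (w 0))
    (by infer_instance) fun w => by simp

instance DF.instImg {n : ℕ} (f : (Fin n → ZFSet.{0}) → ZFSet.{0} → ZFSet.{0})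
    (a : (Fin n → ZFSet.{0}) → ZFSet.{0})
    [hP : DF (fun w : Fin (n + 1) → ZFSet.{0} => f (fun i => w i.succ) (w 0))] [ha : DF a] :
    DF (fun v => img (fun z => f v z) (a v)) := by
  have := ha.rename (fun i => i.succ.succ)
  have : DF (fun w : Fin (n + 2) → ZFSet.{0} => f (fun i => w i.succ.succ) (w 0)) :=
    hP.rename (Fin.cons 0 (fun i => i.succ.succ) : Fin (n + 1) → Fin (n + 2))
  exact .of_mem <| Dfn.congr
    (P := fun w => ∃ z, z ∈ a (fun i => w i.succ) ∧ f (fun i => w i.succ) z = w 0)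
    (by infer_instance) fun w => by simp [img, ZFSet.mem_image]

instance DF.instSUnion {n : ℕ} (a : (Fin n → ZFSet.{0}) → ZFSet.{0}) [ha : DF a] :
    DF (fun v => ZFSet.sUnion (a v)) :=
  .comp₁ (.of_mem <| Dfn.congr (P := fun w => ∃ z, z ∈ w 1 ∧ w 0 ∈ z)
    (by infer_instance) fun w => by simp) ha

instance DF.instPowerset {n : ℕ} (a : (Fin n → ZFSet.{0}) → ZFSet.{0}) [ha : DF a] :
    DF (fun v => ZFSet.powerset (a v)) :=
  .comp₁ (.of_mem <| Dfn.congr (P := fun w => w 0 ⊆ w 1)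
    (by infer_instance) fun w => by simp) ha

instance DF.instInsert {n : ℕ} (a b : (Fin n → ZFSet.{0}) → ZFSet.{0}) [ha : DF a]
    [hb : DF b] : DF (fun v => (insert (a v) (b v) : ZFSet.{0})) :=
  .comp₂ (f := fun a b => insert a b)
    (.of_mem <| Dfn.congr (P := fun w => w 0 = w 1 ∨ w 0 ∈ w 2)
    (by infer_instance) fun w => by simp) ha hb

instance DF.instSingleton {n : ℕ} (a : (Fin n → ZFSet.{0}) → ZFSet.{0}) [ha : DF a] :
    DF (fun v => ({a v} : ZFSet.{0})) :=
  .comp₁ (f := fun a => {a}) (.of_mem <| Dfn.congr (P := fun w => w 0 = w 1)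
    (by infer_instance) fun w => by simp) ha

instance DF.instUnion {n : ℕ} (a b : (Fin n → ZFSet.{0}) → ZFSet.{0}) [ha : DF a]
    [hb : DF b] : DF (fun v => a v ∪ b v) :=
  .comp₂ (f := fun a b => a ∪ b)
    (.of_mem <| Dfn.congr (P := fun w => w 0 ∈ w 1 ∨ w 0 ∈ w 2)
    (by infer_instance) fun w => by simp) ha hb

instance DF.instPair {n : ℕ} (a b : (Fin n → ZFSet.{0}) → ZFSet.{0}) [ha : DF a]
    [hb : DF b] : DF (fun v => ZFSet.pair (a v) (b v)) := by
  unfold ZFSet.pair; infer_instance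

theorem natZ_mem_omega (n : ℕ) : natZ n ∈ omega := by
  induction n with
  | zero => exact omega_zero
  | succ n ih => exact omega_succ ih

theorem natZ_eq_mk (n : ℕ) : natZ n = ZFSet.mk (PSet.ofNat n) := by
  induction n with
  | zero => rfl
  | succ n ih => rw [natZ, ih]; rfl

theorem mem_omega_iff {x : ZFSet.{0}} : x ∈ omega ↔ ∃ n, natZ n = x := by
  constructor
  · refine Quotient.inductionOn x fun x => ?_
    rintro ⟨⟨n⟩, h⟩
    exact ⟨n, (natZ_eq_mk n).trans (ZFSet.sound h).symm⟩
  · rintro ⟨n, rfl⟩; exact natZ_mem_omega n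

theorem mem_omega_iff_forall (x : ZFSet.{0}) :
    x ∈ omega ↔ ∀ K : ZFSet.{0}, (∅ ∈ K ∧ ∀ n, n ∈ K → insert n n ∈ K) → x ∈ K := by
  constructor
  · rintro h K ⟨h₀, h₁⟩
    obtain ⟨n, rfl⟩ := mem_omega_iff.1 h
    induction n with
    | zero => exact h₀
    | succ n ih => exact h₁ _ (ih (natZ_mem_omega n))
  · intro h
    exact h omega ⟨omega_zero, fun n hn => omega_succ hn⟩

instance DF.instOmega {n : ℕ} : DF (fun _ : Fin n → ZFSet.{0} => (omega : ZFSet.{0})) :=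
  .of_mem <| Dfn.congr (by infer_instance) fun w => (mem_omega_iff_forall (w 0)).symm

instance DF.instFuns {n : ℕ} (a b : (Fin n → ZFSet.{0}) → ZFSet.{0}) [ha : DF a]
    [hb : DF b] : DF (fun v => ZFSet.funs (a v) (b v)) :=
  .comp₂ (f := fun a b => ZFSet.funs a b)
    (.of_mem <| Dfn.congr (P := fun w =>
      (∀ p, p ∈ w 0 → ∃ x, x ∈ w 1 ∧ ∃ y, y ∈ w 2 ∧ p = ZFSet.pair x y) ∧
        ∀ z, z ∈ w 1 → ∃ y, ZFSet.pair z y ∈ w 0 ∧ ∀ y', ZFSet.pair z y' ∈ w 0 → y' = y)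
    (by infer_instance) fun w => by
      simp [ZFSet.mem_funs, ZFSet.IsFunc, ExistsUnique, ZFSet.subset_def]) ha hb

/-! ### Definability of functions given by recursion on `∈` -/

theorem mem_img {f : ZFSet.{0} → ZFSet.{0}} {a y : ZFSet.{0}} :
    y ∈ img f a ↔ ∃ x ∈ a, f x = y := by
  simp [img, ZFSet.mem_image]

theorem img_congr {f g : ZFSet.{0} → ZFSet.{0}} {a : ZFSet.{0}} (h : ∀ x ∈ a, f x = g x) :
    img f a = img g a := by
  ext y
  simp only [mem_img]
  exact exists_congr fun x => and_congr_right fun hx => by rw [h x hx]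

/-- The value at `x` of the set-theoretic function `f`. -/
def app (f x : ZFSet.{0}) : ZFSet.{0} :=
  ZFSet.sUnion (ZFSet.sep (fun y => ZFSet.pair x y ∈ f) (ZFSet.sUnion (ZFSet.sUnion f)))

theorem app_eq {f x y : ZFSet.{0}} (h : ZFSet.pair x y ∈ f)
    (h' : ∀ z, ZFSet.pair x z ∈ f → z = y) : app f x = y := by
  have : ZFSet.sep (fun y => ZFSet.pair x y ∈ f) (ZFSet.sUnion (ZFSet.sUnion f)) = {y} := by
    ext z
    simp only [mem_sep, mem_singleton]
    refine ⟨fun hz => h' z hz.2, ?_⟩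
    rintro rfl
    refine ⟨?_, h⟩
    refine mem_sUnion.2 ⟨{x, z}, mem_sUnion.2 ⟨_, h, ?_⟩, ?_⟩ <;> simp [ZFSet.pair]
  rw [app, this, sUnion_singleton]

/-- The graph of `F` restricted to `a`. -/
def graph (F : ZFSet.{0} → ZFSet.{0}) (a : ZFSet.{0}) : ZFSet.{0} :=
  img (fun x => ZFSet.pair x (F x)) a

theorem pair_mem_graph {F : ZFSet.{0} → ZFSet.{0}} {a x y : ZFSet.{0}} :
    ZFSet.pair x y ∈ graph F a ↔ x ∈ a ∧ y = F x := by
  simp only [graph, mem_img, ZFSet.pair_inj]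
  constructor
  · rintro ⟨_, h, rfl, rfl⟩; exact ⟨h, rfl⟩
  · rintro ⟨h, rfl⟩; exact ⟨x, h, rfl, rfl⟩

theorem app_graph {F : ZFSet.{0} → ZFSet.{0}} {a x : ZFSet.{0}} (h : x ∈ a) :
    app (graph F a) x = F x :=
  app_eq (pair_mem_graph.2 ⟨h, rfl⟩) fun _ hz => (pair_mem_graph.1 hz).2

theorem graph_congr {F G : ZFSet.{0} → ZFSet.{0}} {a : ZFSet.{0}} (h : ∀ x ∈ a, F x = G x) :
    graph F a = graph G a :=
  img_congr fun x hx => by rw [h x hx]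

/-- Recursion on `∈`: `recZ Φ γ = Φ γ (graph (recZ Φ) γ)`. -/
def recZ (Φ : ZFSet.{0} → ZFSet.{0} → ZFSet.{0}) : ZFSet.{0} → ZFSet.{0} :=
  ZFSet.mem_wf.fix (C := fun _ => ZFSet.{0}) fun γ ih =>
    Φ γ (graph (fun ν => if h : ν ∈ γ then ih ν h else ∅) γ)

theorem recZ_eq (Φ : ZFSet.{0} → ZFSet.{0} → ZFSet.{0}) (γ : ZFSet.{0}) :
    recZ Φ γ = Φ γ (graph (recZ Φ) γ) := by
  rw [recZ, WellFounded.fix_eq]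
  congr 1
  exact graph_congr fun x hx => by simp [hx]

theorem exists_transitive_mem (γ : ZFSet.{0}) : ∃ T : ZFSet.{0}, T.IsTransitive ∧ γ ∈ T :=
  ⟨_, ZFSet.isTransitive_vonNeumann (Order.succ (ZFSet.rank γ)),
    ZFSet.mem_vonNeumann.2 (Order.lt_succ _)⟩

theorem eq_recZ_iff (Φ : ZFSet.{0} → ZFSet.{0} → ZFSet.{0}) (y γ : ZFSet.{0}) :
    y = recZ Φ γ ↔ ∃ T f : ZFSet.{0}, (∀ a, a ∈ T → a ⊆ T) ∧ γ ∈ T ∧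
      (∀ ν, ν ∈ T → app f ν = Φ ν (graph (fun μ => app f μ) ν)) ∧ y = app f γ := by
  constructor
  · rintro rfl
    obtain ⟨T, hT, hγ⟩ := exists_transitive_mem γ
    refine ⟨T, graph (recZ Φ) T, fun a ha => hT a ha, hγ, fun ν hν => ?_, (app_graph hγ).symm⟩
    rw [app_graph hν, recZ_eq]
    congr 1
    exact graph_congr fun μ hμ => (app_graph (hT ν hν hμ)).symm
  · rintro ⟨T, f, hT, hγ, hf, rfl⟩
    have : ∀ ν, ν ∈ T → app f ν = recZ Φ ν := by
      intro ν
      induction ν using ZFSet.inductionOn with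
      | _ ν ih =>
        intro hν
        rw [hf ν hν, recZ_eq]
        congr 1
        exact graph_congr fun μ hμ => ih μ hμ (hT ν hν hμ)
    exact this γ hγ

instance DF.instApp {n : ℕ} (a b : (Fin n → ZFSet.{0}) → ZFSet.{0}) [ha : DF a]
    [hb : DF b] : DF (fun v => app (a v) (b v)) :=
  .comp₂ (f := fun a b => app a b) (by unfold app; infer_instance) ha hb

instance DF.instGraph {n : ℕ} (f : (Fin n → ZFSet.{0}) → ZFSet.{0} → ZFSet.{0})
    (a : (Fin n → ZFSet.{0}) → ZFSet.{0})
    [hP : DF (fun w : Fin (n + 1) → ZFSet.{0} => f (fun i => w i.succ) (w 0))] [ha : DF a] :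
    DF (fun v => graph (fun z => f v z) (a v)) := by
  unfold graph; infer_instance

instance DF.instRecZ {n : ℕ} (Φ : (Fin n → ZFSet.{0}) → ZFSet.{0} → ZFSet.{0} → ZFSet.{0})
    (a : (Fin n → ZFSet.{0}) → ZFSet.{0})
    [hP : DF (fun w : Fin (n + 2) → ZFSet.{0} => Φ (fun i => w i.succ.succ) (w 1) (w 0))]
    [ha : DF a] :
    DF (fun v => recZ (fun x f => Φ v x f) (a v)) := by
  constructor
  refine Dfn.congr ?_ fun w => (eq_recZ_iff _ _ _).symm
  have := ha.rename (fun i => i.succ.succ.succ)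
  have : Dfn (fun w : Fin (n + 4) → ZFSet.{0} =>
      app (w (Fin.succ 0)) (w 0) = Φ (fun i => w i.succ.succ.succ.succ) (w 0)
        (graph (fun μ => app (w (Fin.succ 0)) μ) (w 0))) := by
    refine Dfn.subst₁ (R := fun w x => app (w (Fin.succ 0)) (w 0) =
      Φ (fun i => w i.succ.succ.succ.succ) (w 0) x) ?_ inferInstance
    have : DF (fun w : Fin (n + 5) → ZFSet.{0} =>
        Φ (fun i => w i.succ.succ.succ.succ.succ) (w (Fin.succ 0)) (w 0)) :=
      hP.rename (Fin.cons 0 (Fin.cons 1 fun i => i.succ.succ.succ.succ.succ) :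
        Fin (n + 2) → Fin (n + 5))
    infer_instance
  infer_instance

/-! ### Ordinal definability -/

theorem isOD_of_DF {n : ℕ} (f : (Fin n → ZFSet.{0}) → ZFSet.{0}) [hf : DF f]
    (v : Fin n → ZFSet.{0}) (hv : ∀ i, IsOrd (v i)) : IsOD (f v) := by
  obtain ⟨φ, hφ⟩ := hf.out
  exact ⟨n, φ, v, hv, fun y => by simp [hφ]⟩

theorem tcl_eq (x : ZFSet.{0}) : tcl x = x ∪ ZFSet.sUnion (img tcl x) := by
  rw [tcl, WellFounded.fix_eq]
  congr 2
  exact img_congr fun y hy => by simp [hy]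

theorem mem_HODClass {x : ZFSet.{0}} (hx : IsOD x) (h : ∀ y ∈ x, y ∈ HODClass) :
    x ∈ HODClass := by
  refine ⟨hx, fun y hy => ?_⟩
  rw [tcl_eq] at hy
  rcases mem_union.1 hy with hy | hy
  · exact (h y hy).1
  · obtain ⟨z, hz, hyz⟩ := mem_sUnion.1 hy
    obtain ⟨u, hu, rfl⟩ := mem_img.1 hz
    exact (h u hu).2 y hyz

theorem IsOrd.isOrdinal {α : ZFSet.{0}} (h : IsOrd α) : α.IsOrdinal :=
  isOrdinal_iff_forall_mem_isTransitive.2 h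

theorem isOrd_iff {α : ZFSet.{0}} : IsOrd α ↔ α.IsOrdinal :=
  isOrdinal_iff_forall_mem_isTransitive.symm

theorem IsOrd.mem {α β : ZFSet.{0}} (h : IsOrd α) (hβ : β ∈ α) : IsOrd β :=
  isOrd_iff.2 (h.isOrdinal.mem hβ)

theorem IsOrd.mem_HODClass {α : ZFSet.{0}} (h : IsOrd α) : α ∈ HODClass := by
  induction α using ZFSet.inductionOn with
  | _ α ih =>
    exact SRPPaper.mem_HODClass
      (isOD_of_DF (fun v : Fin 1 → ZFSet.{0} => v 0) (fun _ => α) fun _ => h)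
      fun y hy => ih y hy (h.mem hy)

theorem pair_mem_HODClass {α β : ZFSet.{0}} (hα : IsOrd α) (hβ : IsOrd β) :
    ZFSet.pair α β ∈ HODClass := by
  have hv : ∀ i, IsOrd ((![α, β] : Fin 2 → ZFSet.{0}) i) := by
    simp [Fin.forall_fin_two, hα, hβ]
  refine mem_HODClass
    (isOD_of_DF (fun v : Fin 2 → ZFSet.{0} => ZFSet.pair (v 0) (v 1)) ![α, β] hv) ?_
  intro y hy
  rcases mem_pair.1 hy with rfl | rfl
  · refine mem_HODClass
      (isOD_of_DF (fun v : Fin 2 → ZFSet.{0} => {v 0}) ![α, β] hv) fun z hz => ?_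
    rw [mem_singleton.1 hz]; exact hα.mem_HODClass
  · refine mem_HODClass
      (isOD_of_DF (fun v : Fin 2 → ZFSet.{0} => {v 0, v 1}) ![α, β] hv) fun z hz => ?_
    rcases mem_pair.1 hz with rfl | rfl
    · exact hα.mem_HODClass
    · exact hβ.mem_HODClass

/-! ### Definability over a structure with restricted parameters -/

/-- The subsets of `X` definable over `(X, ∈, A)` with parameters from `P`. -/
def DefP (A : Set ZFSet.{0}) (X P : ZFSet.{0}) : ZFSet.{0} :=
  ZFSet.sep (fun B => ∃ (n : ℕ) (φ : Fml (n + 1)) (v : Fin n → ZFSet.{0}),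
      (∀ i, v i ∈ P) ∧ B = ZFSet.sep (fun z => SatAB X.toSet A ∅ φ (Fin.cons z v)) X)
    (ZFSet.powerset X)

theorem mem_DefP {A : Set ZFSet.{0}} {X P B : ZFSet.{0}} :
    B ∈ DefP A X P ↔ ∃ (n : ℕ) (φ : Fml (n + 1)) (v : Fin n → ZFSet.{0}),
      (∀ i, v i ∈ P) ∧ B = ZFSet.sep (fun z => SatAB X.toSet A ∅ φ (Fin.cons z v)) X := by
  refine ⟨fun h => (mem_sep.1 h).2, fun h => mem_sep.2 ⟨?_, h⟩⟩
  obtain ⟨n, φ, v, _, rfl⟩ := h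
  exact mem_powerset.2 fun z hz => (mem_sep.1 hz).1

theorem DefP_mono {A : Set ZFSet.{0}} {X P Q : ZFSet.{0}} (h : P ⊆ Q) :
    DefP A X P ⊆ DefP A X Q := by
  intro B hB
  obtain ⟨n, φ, v, hv, rfl⟩ := mem_DefP.1 hB
  exact mem_DefP.2 ⟨n, φ, v, fun i => h (hv i), rfl⟩

theorem natZ_mem_natZ {m n : ℕ} (h : m < n) : natZ m ∈ natZ n := by
  induction n with
  | zero => omega
  | succ n ih =>
    rcases Nat.lt_succ_iff_lt_or_eq.1 h with h | rfl
    · exact mem_insert_iff.2 (Or.inr (ih h))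
    · exact mem_insert_iff.2 (Or.inl rfl)

theorem natZ_injective : Function.Injective natZ := by
  intro m n h
  rcases lt_trichotomy m n with hl | hl | hl
  · exact absurd (h ▸ natZ_mem_natZ hl) (ZFSet.mem_irrefl _)
  · exact hl
  · exact absurd (h ▸ natZ_mem_natZ hl) (ZFSet.mem_irrefl _)

theorem zfToNat_natZ (n : ℕ) : zfToNat (natZ n) = n := by
  have h : ∃ m : ℕ, natZ m = natZ n := ⟨n, rfl⟩
  rw [zfToNat, dif_pos h]
  exact natZ_injective h.choose_spec

/-- The set-theoretic function on `ω` given by a sequence. -/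
def code (e : ℕ → ZFSet.{0}) : ZFSet.{0} := graph (fun m => e (zfToNat m)) omega

theorem app_code (e : ℕ → ZFSet.{0}) (n : ℕ) : app (code e) (natZ n) = e n := by
  rw [code, app_graph (natZ_mem_omega n), zfToNat_natZ]

theorem code_mem_funs {e : ℕ → ZFSet.{0}} {U : ZFSet.{0}} (h : ∀ n, e n ∈ U) :
    code e ∈ funs omega U := by
  rw [mem_funs]
  constructor
  · intro p hp
    rw [code, graph] at hp
    obtain ⟨m, hm, rfl⟩ := mem_img.1 hp
    exact pair_mem_prod.2 ⟨hm, h _⟩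
  · intro z hz
    exact ⟨_, pair_mem_graph.2 ⟨hz, rfl⟩, fun y hy => (pair_mem_graph.1 hy).2⟩

theorem app_mem_of_mem_funs {s a U x : ZFSet.{0}} (hs : s ∈ funs a U) (hx : x ∈ a) :
    app s x ∈ U := by
  rw [mem_funs] at hs
  obtain ⟨y, hy, hy'⟩ := hs.2 x hx
  rw [app_eq hy hy']
  exact (pair_mem_prod.1 (hs.1 hy)).2

/-- The sequence `s` starts with `z` and continues as `t`. -/
def IsCons (t z s : ZFSet.{0}) : Prop :=
  app t ∅ = z ∧ ∀ n, n ∈ omega → app t (insert n n) = app s n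

/-- A family of sets of sequences closed under the logical operations. -/
def SemClosed (a X W K : ZFSet.{0}) : Prop :=
  (∀ i, i ∈ omega → ∀ j, j ∈ omega → ZFSet.sep (fun s => app s i ∈ app s j) W ∈ K) ∧
  (∀ i, i ∈ omega → ∀ j, j ∈ omega → ZFSet.sep (fun s => app s i = app s j) W ∈ K) ∧
  (∀ i, i ∈ omega → ZFSet.sep (fun s => app s i ∈ a) W ∈ K) ∧
  (∀ R, R ∈ K → ZFSet.sep (fun s => ¬ s ∈ R) W ∈ K) ∧
  (∀ R, R ∈ K → ∀ R', R' ∈ K → ZFSet.sep (fun s => s ∈ R ∧ s ∈ R') W ∈ K) ∧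
  (∀ R, R ∈ K →
    ZFSet.sep (fun s => ∃ z, z ∈ X ∧ ∃ t, t ∈ R ∧ IsCons t z s) W ∈ K)

/-- `DefP` defined inside set theory. -/
def DefI (a X P : ZFSet.{0}) : ZFSet.{0} :=
  ZFSet.sep (fun B => ∃ R, (∀ K, SemClosed a X (funs omega (X ∪ P)) K → R ∈ K) ∧
      ∃ s, s ∈ funs omega (X ∪ P) ∧ (∀ i, i ∈ omega → app s i ∈ P) ∧
        B = ZFSet.sep (fun z => ∃ t, t ∈ R ∧ IsCons t z s) X)
    (ZFSet.powerset X)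

instance Dfn.instIsCons {n : ℕ} (a b c : (Fin n → ZFSet.{0}) → ZFSet.{0}) [ha : DF a]
    [hb : DF b] [hc : DF c] : Dfn (fun v => IsCons (a v) (b v) (c v)) :=
  .comp₃ (R := fun a b c => IsCons a b c) (by unfold IsCons; infer_instance) ha hb hc

instance Dfn.instSemClosed {n : ℕ} (a b c d : (Fin n → ZFSet.{0}) → ZFSet.{0}) [ha : DF a]
    [hb : DF b] [hc : DF c] [hd : DF d] : Dfn (fun v => SemClosed (a v) (b v) (c v) (d v)) :=
  .comp₄ (R := fun a b c d => SemClosed a b c d) (by unfold SemClosed; infer_instance)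
    ha hb hc hd

instance DF.instDefI {n : ℕ} (a b c : (Fin n → ZFSet.{0}) → ZFSet.{0}) [ha : DF a]
    [hb : DF b] [hc : DF c] : DF (fun v => DefI (a v) (b v) (c v)) :=
  .comp₃ (f := fun a b c => DefI a b c) (by unfold DefI; infer_instance) ha hb hc

/-- The set of sequences satisfying a formula. -/
def sem (A : Set ZFSet.{0}) (X W : ZFSet.{0}) {n : ℕ} (φ : Fml n) : ZFSet.{0} :=
  ZFSet.sep (fun s => SatAB X.toSet A ∅ φ (fun i => app s (natZ i))) W

theorem sem_rename {A : Set ZFSet.{0}} {X W : ZFSet.{0}} {n m : ℕ} (φ : Fml n)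
    (ρ : Fin n → Fin m) (h : ∀ i, (ρ i : ℕ) = i) : sem A X W (φ.rename ρ) = sem A X W φ := by
  simp [sem, SatAB_rename, h]

theorem exists_isCons_mem_sem {A : Set ZFSet.{0}} {X U z s : ZFSet.{0}} {n : ℕ}
    (φ : Fml (n + 1)) (hz : z ∈ U) (hs : s ∈ funs omega U) :
    (∃ t, t ∈ sem A X (funs omega U) φ ∧ IsCons t z s) ↔
      SatAB X.toSet A ∅ φ (Fin.cons z fun i => app s (natZ i)) := by
  constructor
  · rintro ⟨t, ht, h₀, h₁⟩
    have : (fun i : Fin (n + 1) => app t (natZ i)) = Fin.cons z fun i => app s (natZ i) := by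
      funext i
      refine Fin.cases ?_ (fun i => ?_) i
      · exact h₀
      · exact h₁ _ (natZ_mem_omega _)
    rw [← this]
    exact (mem_sep.1 ht).2
  · intro h
    let e : ℕ → ZFSet.{0} := fun k => Nat.casesOn k z fun k => app s (natZ k)
    have he : ∀ k, e k ∈ U := fun k => by
      cases k with
      | zero => exact hz
      | succ k => exact app_mem_of_mem_funs hs (natZ_mem_omega k)
    refine ⟨code e, mem_sep.2 ⟨code_mem_funs he, ?_⟩, app_code e 0, fun k hk => ?_⟩
    · convert h using 1
      funext i
      rw [app_code]
      refine Fin.cases ?_ (fun i => ?_) i <;> rfl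
    · obtain ⟨k, rfl⟩ := mem_omega_iff.1 hk
      exact app_code e (k + 1)

theorem sem_mem_of_semClosed {a X U K : ZFSet.{0}} (hXU : X ⊆ U)
    (hK : SemClosed a X (funs omega U) K) {n : ℕ} (φ : Fml n) :
    sem a.toSet X (funs omega U) φ ∈ K := by
  obtain ⟨hm, he, ha, hn, hc, hx⟩ := hK
  induction φ with
  | mem i j => exact hm _ (natZ_mem_omega i) _ (natZ_mem_omega j)
  | eq i j => exact he _ (natZ_mem_omega i) _ (natZ_mem_omega j)
  | inA i => exact ha _ (natZ_mem_omega i)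
  | inB i =>
    convert hn _ (he _ omega_zero _ omega_zero) using 1
    ext s
    simp only [sem, SatAB, mem_sep]
    simp
  | not φ ih =>
    convert hn _ ih using 1
    ext s
    simp only [sem, SatAB, mem_sep]
    tauto
  | and φ ψ ih₁ ih₂ =>
    convert hc _ ih₁ _ ih₂ using 1
    ext s
    simp only [sem, SatAB, mem_sep]
    tauto
  | ex φ ih =>
    convert hx _ ih using 1
    ext s
    simp only [sem, SatAB, mem_sep (y := s)]
    refine and_congr_right fun hs => exists_congr fun z => and_congr_right fun hz => ?_
    exact (exists_isCons_mem_sem φ (hXU hz) hs).symm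

/-- The family of all definable sets of sequences. -/
def semFam (A : Set ZFSet.{0}) (X W : ZFSet.{0}) : ZFSet.{0} :=
  ZFSet.sep (fun R => ∃ (n : ℕ) (φ : Fml n), R = sem A X W φ) (ZFSet.powerset W)

theorem mem_semFam {A : Set ZFSet.{0}} {X W R : ZFSet.{0}} :
    R ∈ semFam A X W ↔ ∃ (n : ℕ) (φ : Fml n), R = sem A X W φ := by
  refine ⟨fun h => (mem_sep.1 h).2, fun h => mem_sep.2 ⟨?_, h⟩⟩
  obtain ⟨n, φ, rfl⟩ := h
  exact mem_powerset.2 fun z hz => (mem_sep.1 hz).1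

theorem semClosed_semFam {a X U : ZFSet.{0}} (hXU : X ⊆ U) :
    SemClosed a X (funs omega U) (semFam a.toSet X (funs omega U)) := by
  refine ⟨fun i hi j hj => ?_, fun i hi j hj => ?_, fun i hi => ?_, fun R hR => ?_,
    fun R hR R' hR' => ?_, fun R hR => ?_⟩
  · obtain ⟨i, rfl⟩ := mem_omega_iff.1 hi
    obtain ⟨j, rfl⟩ := mem_omega_iff.1 hj
    exact mem_semFam.2 ⟨i + j + 1, .mem ⟨i, by omega⟩ ⟨j, by omega⟩, rfl⟩
  · obtain ⟨i, rfl⟩ := mem_omega_iff.1 hi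
    obtain ⟨j, rfl⟩ := mem_omega_iff.1 hj
    exact mem_semFam.2 ⟨i + j + 1, .eq ⟨i, by omega⟩ ⟨j, by omega⟩, rfl⟩
  · obtain ⟨i, rfl⟩ := mem_omega_iff.1 hi
    exact mem_semFam.2 ⟨i + 1, .inA ⟨i, by omega⟩, rfl⟩
  · obtain ⟨n, φ, rfl⟩ := mem_semFam.1 hR
    refine mem_semFam.2 ⟨n, .not φ, ?_⟩
    ext s
    simp only [sem, SatAB, mem_sep]
    tauto
  · obtain ⟨n, φ, rfl⟩ := mem_semFam.1 hR
    obtain ⟨m, ψ, rfl⟩ := mem_semFam.1 hR'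
    refine mem_semFam.2 ⟨n + m, .and (φ.rename (Fin.castLE (by omega)))
      (ψ.rename (Fin.castLE (by omega))), ?_⟩
    ext s
    simp only [sem, SatAB, mem_sep, SatAB_rename, Fin.val_castLE]
    tauto
  · obtain ⟨n, φ, rfl⟩ := mem_semFam.1 hR
    refine mem_semFam.2 ⟨n, .ex (φ.rename Fin.castSucc), ?_⟩
    ext s
    rw [← sem_rename φ Fin.castSucc fun i => rfl]
    rw [mem_sep, sem.eq_def _ _ _ (Fml.ex _), mem_sep]
    refine and_congr_right fun hs => exists_congr fun z => and_congr_right fun hz => ?_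
    exact exists_isCons_mem_sem _ (hXU hz) hs

theorem DefI_eq {a X P : ZFSet.{0}} (hP : ∅ ∈ P) : DefI a X P = DefP a.toSet X P := by
  have hX : X ⊆ X ∪ P := fun z hz => mem_union.2 (Or.inl hz)
  ext B
  rw [mem_DefP]
  constructor
  · intro h
    obtain ⟨-, R, hR, s, hs, hsP, rfl⟩ := mem_sep.1 h
    obtain ⟨n, φ, rfl⟩ := mem_semFam.1 (hR _ (semClosed_semFam hX))
    refine ⟨n, φ.rename Fin.castSucc, fun i => app s (natZ i),
      fun i => hsP _ (natZ_mem_omega i), ?_⟩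
    ext z
    rw [mem_sep, mem_sep, ← sem_rename φ Fin.castSucc fun i => rfl]
    exact and_congr_right fun hz => exists_isCons_mem_sem _ (hX hz) hs
  · rintro ⟨n, φ, v, hv, rfl⟩
    let e : ℕ → ZFSet.{0} := fun k => if h : k < n then v ⟨k, h⟩ else ∅
    have he : ∀ k, e k ∈ P := fun k => by
      by_cases h : k < n <;> simp [e, h, hv, hP]
    have hs : code e ∈ funs omega (X ∪ P) :=
      code_mem_funs fun k => mem_union.2 (Or.inr (he k))
    refine mem_sep.2 ⟨mem_powerset.2 fun z hz => (mem_sep.1 hz).1,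
      sem a.toSet X (funs omega (X ∪ P)) φ, fun K hK => sem_mem_of_semClosed hX hK φ, code e,
      hs, fun i hi => ?_, ?_⟩
    · obtain ⟨i, rfl⟩ := mem_omega_iff.1 hi
      rw [app_code]; exact he i
    · ext z
      rw [mem_sep, mem_sep]
      refine and_congr_right fun hz => ?_
      rw [exists_isCons_mem_sem _ (hX hz) hs]
      have : (fun i : Fin n => app (code e) (natZ i)) = v := by
        funext i; rw [app_code]; simp [e]
      rw [this]

theorem DefSetA_eq_DefP {A : Set ZFSet.{0}} {X : ZFSet.{0}} (hX : ∅ ∈ X ∨ X = ∅) :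
    DefSetA A X = DefP A X (insert ∅ X) := by
  rcases hX with hX | rfl
  · have : insert ∅ X = X := by
      ext z; rw [mem_insert_iff]
      exact ⟨fun h => h.elim (fun h => h ▸ hX) id, Or.inr⟩
    rw [this]; rfl
  · ext B
    rw [mem_DefP, DefSetA, mem_sep]
    constructor
    · rintro ⟨-, n, φ, v, hv, h⟩
      exact ⟨n, φ, v, fun i => absurd (hv i) (ZFSet.notMem_empty _), h⟩
    · rintro ⟨n, φ, v, hv, rfl⟩
      refine ⟨mem_powerset.2 fun z hz => (mem_sep.1 hz).1, 0, .eq 0 0, Fin.elim0,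
        fun i => i.elim0, ?_⟩
      ext z; simp

/-- The definable subsets of `X` with parameters from `P ∪ {∅}`. -/
def DefE (a X P : ZFSet.{0}) : ZFSet.{0} := DefP a.toSet X (insert ∅ P)

instance DF.instDefE {n : ℕ} (a b c : (Fin n → ZFSet.{0}) → ZFSet.{0}) [ha : DF a]
    [hb : DF b] [hc : DF c] : DF (fun v => DefE (a v) (b v) (c v)) := by
  have : (fun v => DefE (a v) (b v) (c v)) = fun v => DefI (a v) (b v) (insert ∅ (c v)) := by
    funext v
    rw [DefI_eq (mem_insert_iff.2 (Or.inl rfl))]; rfl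
  rw [this]; infer_instance

/-- The stages of the hierarchy `L[a]`. -/
def Lz (a γ : ZFSet.{0}) : ZFSet.{0} := LstageA a.toSet γ

theorem mem_Lz {a γ y : ZFSet.{0}} :
    y ∈ Lz a γ ↔ ∃ β ∈ γ, y ∈ DefP a.toSet (Lz a β) (Lz a β) := by
  have : Lz a γ = ZFSet.sUnion (img (fun β => DefSetA a.toSet (Lz a β)) γ) := by
    rw [Lz, LstageA, WellFounded.fix_eq]
    congr 1
    exact img_congr fun β hβ => by simp only [hβ, dif_pos]; rfl
  rw [this]
  simp only [mem_sUnion, mem_img]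
  constructor
  · rintro ⟨_, ⟨β, hβ, rfl⟩, hy⟩; exact ⟨β, hβ, hy⟩
  · rintro ⟨β, hβ, hy⟩; exact ⟨_, ⟨β, hβ, rfl⟩, hy⟩

theorem empty_mem_DefP (A : Set ZFSet.{0}) (X P : ZFSet.{0}) : ∅ ∈ DefP A X P := by
  refine mem_DefP.2 ⟨0, .not (.eq 0 0), Fin.elim0, fun i => i.elim0, ?_⟩
  ext z; simp [SatAB]

theorem empty_mem_Lz (a γ : ZFSet.{0}) : ∅ ∈ Lz a γ ∨ Lz a γ = ∅ := by
  rcases (Lz a γ).eq_empty_or_nonempty with h | ⟨y, hy⟩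
  · exact Or.inr h
  · obtain ⟨β, hβ, _⟩ := mem_Lz.1 hy
    exact Or.inl (mem_Lz.2 ⟨β, hβ, empty_mem_DefP _ _ _⟩)

theorem mem_Lz' {a γ y : ZFSet.{0}} :
    y ∈ Lz a γ ↔ ∃ β ∈ γ, y ∈ DefE a (Lz a β) (Lz a β) := by
  rw [mem_Lz]
  refine exists_congr fun β => and_congr_right fun _ => ?_
  rw [DefE, ← DefSetA_eq_DefP (empty_mem_Lz a β)]
  rfl

theorem Lz_eq_recZ (a γ : ZFSet.{0}) : Lz a γ = recZ (fun γ f =>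
    ZFSet.sUnion (img (fun β => DefE a (app f β) (app f β)) γ)) γ := by
  induction γ using ZFSet.inductionOn with
  | _ γ ih =>
    rw [recZ_eq]
    ext y
    rw [mem_Lz']
    simp only [mem_sUnion, mem_img]
    constructor
    · rintro ⟨β, hβ, hy⟩
      exact ⟨_, ⟨β, hβ, rfl⟩, by rwa [app_graph hβ, ← ih β hβ]⟩
    · rintro ⟨_, ⟨β, hβ, rfl⟩, hy⟩
      exact ⟨β, hβ, by rwa [app_graph hβ, ← ih β hβ] at hy⟩

instance DF.instLz {n : ℕ} (a b : (Fin n → ZFSet.{0}) → ZFSet.{0}) [ha : DF a]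
    [hb : DF b] : DF (fun v => Lz (a v) (b v)) := by
  refine .comp₂ (f := fun a b => Lz a b) ?_ ha hb
  simp only [Lz_eq_recZ]
  infer_instance

/-! ### Hulls of small sets of ordinals in the constructible hierarchy -/

/-- `ν` is the least stage at which an element of `B` appears. -/
def LeastHit (y B ν : ZFSet.{0}) : Prop :=
  (∃ z, z ∈ B ∧ z ∈ Lz y ν) ∧ ∀ μ, μ ∈ ν → ¬ ∃ z, z ∈ B ∧ z ∈ Lz y μ

/-- `ν'` is the successor of `ν`, or the least stage meeting a set definable over `Lz y γ` from
parameters in `P`. -/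
def NextIdx (y γ P ν ν' : ZFSet.{0}) : Prop :=
  ν' = insert ν ν ∨ ∃ B, B ∈ DefE ∅ (Lz y γ) P ∧ LeastHit y B ν'

/-- The initial indices. -/
def BaseIdx (l ξ γ ν : ZFSet.{0}) : Prop :=
  ν ∈ ξ ∨ ν = l ∨ γ = insert ν ν

/-- The family `f` of sets having been constructed, `H` is closed under the generation of
indices. -/
def IdxClosed (y l ξ γ f H : ZFSet.{0}) : Prop :=
  (∀ ν, ν ∈ γ → BaseIdx l ξ γ ν → ν ∈ H) ∧
    ∀ ν, ν ∈ H → ν ∈ γ → ∀ ν', ν' ∈ γ → NextIdx y γ (app f ν) ν ν' → ν' ∈ H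

/-- The set of indices generated from the family `f`. -/
def idxSet (y l ξ γ f : ZFSet.{0}) : ZFSet.{0} :=
  ZFSet.sep (fun ν => ∀ H, IdxClosed y l ξ γ f H → ν ∈ H) γ

/-- The hull of `ξ ∪ {l}` in `Lz y γ`. -/
def hull (y l ξ γ : ZFSet.{0}) : ZFSet.{0} :=
  recZ (fun γ f =>
    ZFSet.sUnion (img (fun ν => DefE y (Lz y ν) (app f ν)) (idxSet y l ξ γ f))) γ

/-- The set of indices of stages used by `hull y l ξ γ`. -/
def idx (y l ξ γ : ZFSet.{0}) : ZFSet.{0} :=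
  idxSet y l ξ γ (graph (hull y l ξ) γ)

section Definability
variable {n : ℕ} (a b c d e f : (Fin n → ZFSet.{0}) → ZFSet.{0})

instance Dfn.instLeastHit [ha : DF a] [hb : DF b] [hc : DF c] :
    Dfn (fun v => LeastHit (a v) (b v) (c v)) :=
  .comp₃ (R := fun a b c => LeastHit a b c) (by unfold LeastHit; infer_instance) ha hb hc

instance Dfn.instNextIdx [ha : DF a] [hb : DF b] [hc : DF c] [hd : DF d] [he : DF e] :
    Dfn (fun v => NextIdx (a v) (b v) (c v) (d v) (e v)) :=
  .comp₅ (R := fun a b c d e => NextIdx a b c d e) (by unfold NextIdx; infer_instance)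
    ha hb hc hd he

instance Dfn.instBaseIdx [ha : DF a] [hb : DF b] [hc : DF c] [hd : DF d] :
    Dfn (fun v => BaseIdx (a v) (b v) (c v) (d v)) :=
  .comp₄ (R := fun a b c d => BaseIdx a b c d) (by unfold BaseIdx; infer_instance) ha hb hc hd

instance Dfn.instIdxClosed [ha : DF a] [hb : DF b] [hc : DF c] [hd : DF d] [he : DF e]
    [hf : DF f] : Dfn (fun v => IdxClosed (a v) (b v) (c v) (d v) (e v) (f v)) :=
  .comp₆ (R := fun a b c d e f => IdxClosed a b c d e f)
    (by unfold IdxClosed; infer_instance) ha hb hc hd he hf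

instance DF.instIdxSet [ha : DF a] [hb : DF b] [hc : DF c] [hd : DF d] [he : DF e] :
    DF (fun v => idxSet (a v) (b v) (c v) (d v) (e v)) :=
  .comp₅ (f := fun a b c d e => idxSet a b c d e) (by unfold idxSet; infer_instance)
    ha hb hc hd he

instance DF.instHull [ha : DF a] [hb : DF b] [hc : DF c] [hd : DF d] :
    DF (fun v => hull (a v) (b v) (c v) (d v)) :=
  .comp₄ (f := fun a b c d => hull a b c d) (by unfold hull; infer_instance) ha hb hc hd

end Definability

section Idx
variable {y l ξ γ : ZFSet.{0}}

theorem mem_idx {ν : ZFSet.{0}} : ν ∈ idx y l ξ γ ↔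
    ν ∈ γ ∧ ∀ H, IdxClosed y l ξ γ (graph (hull y l ξ) γ) H → ν ∈ H := by
  rw [idx, idxSet, mem_sep]

theorem idx_subset : idx y l ξ γ ⊆ γ := fun _ h => (mem_idx.1 h).1

theorem mem_hull {z : ZFSet.{0}} :
    z ∈ hull y l ξ γ ↔ ∃ ν ∈ idx y l ξ γ, z ∈ DefE y (Lz y ν) (hull y l ξ ν) := by
  rw [hull, recZ_eq]
  simp only [mem_sUnion, mem_img]
  constructor
  · rintro ⟨_, ⟨ν, hν, rfl⟩, hz⟩
    refine ⟨ν, hν, ?_⟩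
    rwa [app_graph (idx_subset hν)] at hz
  · rintro ⟨ν, hν, hz⟩
    refine ⟨_, ⟨ν, hν, rfl⟩, ?_⟩
    rwa [app_graph (idx_subset hν)]

theorem idx_base {ν : ZFSet.{0}} (hν : ν ∈ γ) (h : BaseIdx l ξ γ ν) : ν ∈ idx y l ξ γ :=
  mem_idx.2 ⟨hν, fun _ hH => hH.1 ν hν h⟩

theorem idx_next {ν ν' : ZFSet.{0}} (hν : ν ∈ idx y l ξ γ) (hν' : ν' ∈ γ)
    (h : NextIdx y γ (hull y l ξ ν) ν ν') : ν' ∈ idx y l ξ γ := by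
  refine mem_idx.2 ⟨hν', fun H hH => ?_⟩
  obtain ⟨h₁, h₂⟩ := mem_idx.1 hν
  refine hH.2 ν (h₂ H hH) h₁ ν' hν' ?_
  rwa [app_graph h₁]

theorem idx_induction {p : ZFSet.{0} → Prop} (h₀ : ∀ ν ∈ γ, BaseIdx l ξ γ ν → p ν)
    (h₁ : ∀ ν ∈ γ, p ν → ∀ ν' ∈ γ, NextIdx y γ (hull y l ξ ν) ν ν' → p ν') {ν : ZFSet.{0}}
    (hν : ν ∈ idx y l ξ γ) : p ν := by
  refine (mem_sep.1 ((mem_idx.1 hν).2 (ZFSet.sep p γ) ⟨fun ν hν h => ?_, ?_⟩)).2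
  · exact mem_sep.2 ⟨hν, h₀ ν hν h⟩
  · intro ν hν hνγ ν' hν' h
    rw [app_graph hνγ] at h
    exact mem_sep.2 ⟨hν', h₁ ν hνγ (mem_sep.1 hν).2 ν' hν' h⟩

theorem DefE_mono {a X P Q : ZFSet.{0}} (h : P ⊆ Q) : DefE a X P ⊆ DefE a X Q :=
  DefP_mono fun _ hz => mem_insert_iff.2 ((mem_insert_iff.1 hz).imp_right fun h' => h h')

theorem idx_mono_of {ξ' : ZFSet.{0}} (h : ξ ⊆ ξ')
    (hG : ∀ ν ∈ γ, hull y l ξ ν ⊆ hull y l ξ' ν) : idx y l ξ γ ⊆ idx y l ξ' γ := by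
  intro ν hν
  refine idx_induction (p := fun ν => ν ∈ idx y l ξ' γ) ?_ ?_ hν
  · exact fun ν hν hb => idx_base hν (hb.imp_left fun h' => h h')
  · intro ν hν h₁ ν' hν' hn
    exact idx_next h₁ hν' (hn.imp_right fun ⟨B, hB, hB'⟩ => ⟨B, DefE_mono (hG ν hν) hB, hB'⟩)

theorem hull_mono {ξ' : ZFSet.{0}} (h : ξ ⊆ ξ') : hull y l ξ γ ⊆ hull y l ξ' γ := by
  induction γ using ZFSet.inductionOn with
  | _ γ ih =>
    intro z hz
    obtain ⟨ν, hν, hz⟩ := mem_hull.1 hz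
    exact mem_hull.2 ⟨ν, idx_mono_of h ih hν, DefE_mono (ih ν (idx_subset hν)) hz⟩

theorem idx_mono {ξ' : ZFSet.{0}} (h : ξ ⊆ ξ') : idx y l ξ γ ⊆ idx y l ξ' γ :=
  idx_mono_of h fun _ _ => hull_mono h

end Idx

/-! ### Sets of cardinality at most the continuum -/

open Cardinal in
/-- `x` has at most continuum many elements. -/
def Small (x : ZFSet.{0}) : Prop := #x.toSet ≤ 𝔠

theorem codeF_injective : ∀ {n : ℕ} (φ ψ : Fml n), codeF φ = codeF ψ → φ = ψ := by
  intro n φ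
  induction φ with
  | mem i j =>
    intro ψ; cases ψ <;> simp [codeF, Nat.pair_eq_pair, Fin.ext_iff]
  | eq i j =>
    intro ψ; cases ψ <;> simp [codeF, Nat.pair_eq_pair, Fin.ext_iff]
  | inA i =>
    intro ψ; cases ψ <;> simp [codeF, Nat.pair_eq_pair, Fin.ext_iff]
  | inB i =>
    intro ψ; cases ψ <;> simp [codeF, Nat.pair_eq_pair, Fin.ext_iff]
  | not φ ih =>
    intro ψ; cases ψ <;> simp [codeF, Nat.pair_eq_pair]
    exact ih _
  | and φ₁ φ₂ ih₁ ih₂ =>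
    intro ψ; cases ψ <;> simp [codeF, Nat.pair_eq_pair]
    exact fun h₁ h₂ => ⟨ih₁ _ h₁, ih₂ _ h₂⟩
  | ex φ ih =>
    intro ψ; cases ψ <;> simp [codeF, Nat.pair_eq_pair]
    exact ih _

instance countable_fml (n : ℕ) : Countable (Fml n) :=
  ⟨codeF, fun φ ψ h => codeF_injective φ ψ h⟩

theorem mem_toSet_iff {x y : ZFSet.{0}} : x ∈ y.toSet ↔ x ∈ y := Iff.rfl

open Cardinal in
theorem Small.mono {x y : ZFSet.{0}} (hy : Small y) (h : x ⊆ y) : Small x :=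
  (Cardinal.mk_le_mk_of_subset (show x.toSet ⊆ y.toSet from fun _ hz => h hz)).trans hy

open Cardinal in
theorem Small.union {x y : ZFSet.{0}} (hx : Small x) (hy : Small y) : Small (x ∪ y) := by
  have : (x ∪ y).toSet = x.toSet ∪ y.toSet := by ext; simp [mem_toSet_iff]
  rw [Small, this]
  refine (Cardinal.mk_union_le _ _).trans ?_
  exact (add_le_add hx hy).trans (by simp)

open Cardinal in
theorem Small.singleton (x : ZFSet.{0}) : Small {x} := by
  have : ({x} : ZFSet.{0}).toSet = {x} := by ext; simp [mem_toSet_iff]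
  rw [Small, this, Cardinal.mk_singleton]
  exact Cardinal.one_le_aleph0.trans Cardinal.aleph0_le_continuum

open Cardinal in
theorem Small.insert {y : ZFSet.{0}} (hy : Small y) (x : ZFSet.{0}) : Small (insert x y) := by
  refine ((Small.singleton x).union hy).mono fun z hz => ?_
  simpa using hz

open Cardinal in
theorem Small.img {x : ZFSet.{0}} (hx : Small x) (f : ZFSet.{0} → ZFSet.{0}) :
    Small (img f x) := by
  have : (SRPPaper.img f x).toSet = f '' x.toSet := by ext; simp [mem_toSet_iff, mem_img]
  rw [Small, this]
  exact Cardinal.mk_image_le.trans hx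

open Cardinal in
theorem Small.sUnion_img {x : ZFSet.{0}} (hx : Small x) (f : ZFSet.{0} → ZFSet.{0})
    (hf : ∀ z ∈ x, Small (f z)) : Small (ZFSet.sUnion (SRPPaper.img f x)) := by
  have : (ZFSet.sUnion (SRPPaper.img f x)).toSet = ⋃ z ∈ x.toSet, (f z).toSet := by
    ext; simp [mem_toSet_iff, mem_img]
  rw [Small, this]
  refine (Cardinal.mk_biUnion_le _ _).trans ?_
  refine (mul_le_mul' hx (ciSup_le' fun z : x.toSet => hf z z.2)).trans ?_
  simp

open Cardinal in
theorem Small.omega : Small omega := by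
  have : ZFSet.omega.toSet = Set.range natZ := by ext; simp [mem_toSet_iff, mem_omega_iff]
  rw [Small, this]
  exact (Set.countable_range natZ).le_aleph0.trans Cardinal.aleph0_le_continuum

open Cardinal in
theorem Small.powerset_omega : Small (ZFSet.powerset ZFSet.omega) := by
  let f : ZFSet.{0} → ULift.{1} (Set ℕ) := fun x => ⟨{n | natZ n ∈ x}⟩
  have hf : Set.InjOn f (ZFSet.powerset ZFSet.omega).toSet := by
    intro x hx y hy h
    have h' : {n | natZ n ∈ x} = {n | natZ n ∈ y} := congrArg ULift.down h
    have hx : x ⊆ ZFSet.omega := by simpa [mem_toSet_iff] using hx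
    have hy : y ⊆ ZFSet.omega := by simpa [mem_toSet_iff] using hy
    ext z
    constructor <;> intro hz
    · obtain ⟨n, rfl⟩ := mem_omega_iff.1 (hx hz)
      exact (Set.ext_iff.1 h' n).1 hz
    · obtain ⟨n, rfl⟩ := mem_omega_iff.1 (hy hz)
      exact (Set.ext_iff.1 h' n).2 hz
  rw [Small, ← Cardinal.mk_image_eq_of_injOn _ _ hf]
  refine (Cardinal.mk_set_le _).trans ?_
  simp

open Cardinal in
theorem Small.DefP {P : ZFSet.{0}} (hP : Small P) (A : Set ZFSet.{0}) (X : ZFSet.{0}) :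
    Small (DefP A X P) := by
  let f : (Σ n : ℕ, Fml (n + 1) × (Fin n → P.toSet)) → ZFSet.{0} := fun p =>
    ZFSet.sep (fun z => SatAB X.toSet A ∅ p.2.1 (Fin.cons z fun i => (p.2.2 i : ZFSet.{0}))) X
  have h : (SRPPaper.DefP A X P).toSet ⊆ Set.range f := by
    intro B hB
    obtain ⟨n, φ, v, hv, rfl⟩ := mem_DefP.1 hB
    exact ⟨⟨n, φ, fun i => ⟨v i, hv i⟩⟩, rfl⟩
  refine (Cardinal.mk_le_mk_of_subset h).trans (Cardinal.mk_range_le.trans ?_)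
  rw [Cardinal.mk_sigma]
  refine (Cardinal.sum_le_lift_mk_mul_iSup _).trans ?_
  refine (mul_le_mul' (b := 𝔠) (d := 𝔠) ?_ (ciSup_le' fun n => ?_)).trans (by simp)
  · simp [Cardinal.aleph0_le_continuum]
  · rw [Cardinal.mk_prod]
    refine (mul_le_mul' (b := 𝔠) (d := 𝔠) ?_ ?_).trans (by simp)
    · rw [Cardinal.lift_le_continuum]
      exact Cardinal.mk_le_aleph0.trans Cardinal.aleph0_le_continuum
    · rw [Cardinal.lift_id', Cardinal.mk_pi, Cardinal.prod_const, Cardinal.mk_fin,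
        Cardinal.lift_natCast]
      refine (Cardinal.power_le_power_right (c := (n : Cardinal))
        (Cardinal.lift_le_continuum.2 hP)).trans ?_
      exact_mod_cast Cardinal.power_nat_le Cardinal.aleph0_le_continuum

theorem Small.DefE {P : ZFSet.{0}} (hP : Small P) (a X : ZFSet.{0}) : Small (DefE a X P) :=
  (hP.insert ∅).DefP _ _

theorem LeastHit.unique {y B ν μ : ZFSet.{0}} (hν : LeastHit y B ν) (hμ : LeastHit y B μ)
    (h : IsOrd ν) (h' : IsOrd μ) : ν = μ := by
  rcases (isOrd_iff.1 h).mem_trichotomous (isOrd_iff.1 h') with h | h | h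
  · exact (hμ.2 _ h hν.1).elim
  · exact h
  · exact (hν.2 _ h hμ.1).elim

theorem insert_self_injective {ν μ : ZFSet.{0}}
    (h : (Insert.insert ν ν : ZFSet.{0}) = Insert.insert μ μ) : ν = μ := by
  by_contra hne
  have h₁ : ν ∈ (Insert.insert μ μ : ZFSet.{0}) := h ▸ mem_insert_iff.2 (.inl rfl)
  have h₂ : μ ∈ (Insert.insert ν ν : ZFSet.{0}) := h ▸ mem_insert_iff.2 (.inl rfl)
  exact ZFSet.mem_asymm ((mem_insert_iff.1 h₁).resolve_left hne)
    ((mem_insert_iff.1 h₂).resolve_left (Ne.symm hne))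

theorem Small.of_iterate {T : ℕ → ZFSet.{0}} (hT : ∀ n, Small (T n)) {x : ZFSet.{0}}
    (h : ∀ z ∈ x, ∃ n, z ∈ T n) : Small x := by
  refine (Small.omega.sUnion_img (fun m => T (zfToNat m)) fun _ _ => hT _).mono fun z hz => ?_
  obtain ⟨n, hn⟩ := h z hz
  refine mem_sUnion.2 ⟨_, mem_img.2 ⟨natZ n, natZ_mem_omega n, rfl⟩, ?_⟩
  rwa [zfToNat_natZ]

theorem Small.idx {y l ξ γ : ZFSet.{0}} (hγ : IsOrd γ) (hξ : Small ξ)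
    (hG : ∀ ν ∈ γ, Small (hull y l ξ ν)) : Small (idx y l ξ γ) := by
  let hit : ZFSet.{0} → ZFSet.{0} := fun B =>
    if h : ∃ ν ∈ γ, LeastHit y B ν then h.choose else ∅
  let next : ZFSet.{0} → ZFSet.{0} := fun ν =>
    Insert.insert (Insert.insert ν ν) (SRPPaper.img hit (SRPPaper.DefE ∅ (Lz y γ) (hull y l ξ ν)))
  let prev : ZFSet.{0} := if h : ∃ ν, γ = Insert.insert ν ν then h.choose else ∅
  let T : ℕ → ZFSet.{0} := fun n => Nat.rec (γ ∩ Insert.insert prev (Insert.insert l ξ))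
    (fun _ t => γ ∩ ZFSet.sUnion (SRPPaper.img next t)) n
  have hTγ : ∀ n, T n ⊆ γ := by
    rintro (_ | n) <;> exact fun z hz => (mem_inter.1 hz).1
  refine Small.of_iterate (T := T) (fun n => ?_) fun ν hν => ?_
  · induction n with
    | zero => exact ((hξ.insert l).insert prev).mono fun z hz => (mem_inter.1 hz).2
    | succ n ih =>
      refine Small.mono ?_ fun z hz => (mem_inter.1 hz).2
      exact ih.sUnion_img next fun ν hν => ((hG ν (hTγ n hν)).DefE _ _ |>.img _).insert _
  · refine idx_induction (p := fun ν => ∃ n, ν ∈ T n) ?_ ?_ hν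
    · intro ν hν hb
      refine ⟨0, mem_inter.2 ⟨hν, ?_⟩⟩
      rw [mem_insert_iff, mem_insert_iff]
      rcases hb with h | h | h
      · exact .inr (.inr h)
      · exact .inr (.inl h)
      · have hex : ∃ ν, γ = Insert.insert ν ν := ⟨ν, h⟩
        left
        simp only [prev, dif_pos hex]
        exact insert_self_injective (h.symm.trans hex.choose_spec)
    · rintro ν hν ⟨n, hn⟩ ν' hν' h
      refine ⟨n + 1, mem_inter.2 ⟨hν', mem_sUnion.2 ⟨next ν, mem_img.2 ⟨ν, hn, rfl⟩, ?_⟩⟩⟩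
      rw [mem_insert_iff]
      refine h.imp_right fun ⟨B, hB, hB'⟩ => mem_img.2 ⟨B, hB, ?_⟩
      have hex : ∃ ν ∈ γ, LeastHit y B ν := ⟨ν', hν', hB'⟩
      simp only [hit, dif_pos hex]
      exact LeastHit.unique hex.choose_spec.2 hB' (hγ.mem hex.choose_spec.1) (hγ.mem hν')

theorem Small.hull {y l ξ γ : ZFSet.{0}} (hγ : IsOrd γ) (hξ : Small ξ) :
    Small (hull y l ξ γ) := by
  induction γ using ZFSet.inductionOn with
  | _ γ ih =>
    have hG : ∀ ν ∈ γ, Small (SRPPaper.hull y l ξ ν) := fun ν hν => ih ν hν (hγ.mem hν)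
    refine ((Small.idx hγ hξ hG).sUnion_img
      (fun ν => SRPPaper.DefE y (Lz y ν) (SRPPaper.hull y l ξ ν))
      fun ν hν => (hG ν (idx_subset hν)).DefE _ _).mono fun z hz => ?_
    obtain ⟨ν, hν, hz⟩ := mem_hull.1 hz
    exact mem_sUnion.2 ⟨_, mem_img.2 ⟨ν, hν, rfl⟩, hz⟩

/-! ### The constructible hierarchy -/

theorem IsOrd.mem_of_subset_of_mem {α β γ : ZFSet.{0}} (hγ : IsOrd γ) (hα : IsOrd α)
    (h : α ⊆ β) (hβ : β ∈ γ) : α ∈ γ := by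
  rcases (hα.isOrdinal.subset_iff_eq_or_mem (hγ.mem hβ).isOrdinal).1 h with rfl | h
  · exact hβ
  · exact hγ.1.mem_trans h hβ

theorem IsOrd.subset_or_mem {α β : ZFSet.{0}} (hα : IsOrd α) (hβ : IsOrd β) : α ⊆ β ∨ β ∈ α := by
  rcases hα.isOrdinal.mem_trichotomous hβ.isOrdinal with h | rfl | h
  · exact .inl (hβ.1 _ h)
  · exact .inl fun _ h => h
  · exact .inr h

theorem IsOrd.succ {α : ZFSet.{0}} (hα : IsOrd α) : IsOrd (insert α α) := by
  refine ⟨fun y hy z hz => ?_, fun y hy => ?_⟩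
  · rcases mem_insert_iff.1 hy with rfl | hy
    · exact mem_insert_iff.2 (.inr hz)
    · exact mem_insert_iff.2 (.inr (hα.1 _ hy hz))
  · rcases mem_insert_iff.1 hy with rfl | hy
    · exact hα.1
    · exact hα.2 y hy

theorem IsOrd.succ_subset {α β : ZFSet.{0}} (hα : IsOrd α) (h : β ∈ α) : insert β β ⊆ α := by
  intro z hz
  rcases mem_insert_iff.1 hz with rfl | hz
  · exact h
  · exact hα.1 _ h hz

theorem subset_Lz_of_mem_DefP {a X P y : ZFSet.{0}} (h : y ∈ DefP a.toSet X P) : y ⊆ X := by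
  obtain ⟨n, φ, v, -, rfl⟩ := mem_DefP.1 h
  exact fun z hz => (mem_sep.1 hz).1

theorem Lz_mono {a β γ : ZFSet.{0}} (h : β ⊆ γ) : Lz a β ⊆ Lz a γ := by
  intro z hz
  obtain ⟨ν, hν, hz⟩ := mem_Lz.1 hz
  exact mem_Lz.2 ⟨ν, h hν, hz⟩

theorem Lz_transitive {a γ : ZFSet.{0}} (hγ : IsOrd γ) : (Lz a γ).IsTransitive := by
  intro y hy
  obtain ⟨β, hβ, hy⟩ := mem_Lz.1 hy
  exact fun z hz => Lz_mono (hγ.1 _ hβ) (subset_Lz_of_mem_DefP hy hz)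

theorem mem_DefP_self {A : Set ZFSet.{0}} {X P z : ZFSet.{0}} (hX : X.IsTransitive) (hz : z ∈ X)
    (hzP : z ∈ P) : z ∈ DefP A X P := by
  refine mem_DefP.2 ⟨1, .mem 0 1, fun _ => z, fun _ => hzP, ?_⟩
  ext u
  rw [mem_sep]
  simp only [SatAB, Fin.cons_zero]
  exact ⟨fun h => ⟨hX _ hz h, h⟩, fun h => h.2⟩

/-- The formula expressing that the variable is a transitive set of transitive sets. -/
def ordFml : Fml 1 :=
  .and (.not (.ex (.and (.mem 0 1) (.ex (.and (.mem 0 1) (.not (.mem 0 2)))))))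
    (.not (.ex (.and (.mem 0 1) (.ex (.and (.mem 0 1) (.ex (.and (.mem 0 1)
      (.not (.mem 0 2)))))))))

theorem sat_ordFml {X z : ZFSet.{0}} {A B : Set ZFSet.{0}} (hX : X.IsTransitive) (hz : z ∈ X)
    (v : Fin 0 → ZFSet.{0}) : SatAB X.toSet A B ordFml (Fin.cons z v) ↔ IsOrd z := by
  have e1 : ∀ y : ZFSet.{0}, (Fin.cons y (Fin.cons z v) : Fin 2 → ZFSet.{0}) 1 = z := fun _ => rfl
  have e2 : ∀ y w : ZFSet.{0},
    (Fin.cons w (Fin.cons y (Fin.cons z v)) : Fin 3 → ZFSet.{0}) 1 = y := fun _ _ => rfl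
  have e3 : ∀ y w : ZFSet.{0},
    (Fin.cons w (Fin.cons y (Fin.cons z v)) : Fin 3 → ZFSet.{0}) 2 = z := fun _ _ => rfl
  have e4 : ∀ y w u : ZFSet.{0},
    (Fin.cons u (Fin.cons w (Fin.cons y (Fin.cons z v))) : Fin 4 → ZFSet.{0}) 1 = w :=
    fun _ _ _ => rfl
  have e5 : ∀ y w u : ZFSet.{0},
    (Fin.cons u (Fin.cons w (Fin.cons y (Fin.cons z v))) : Fin 4 → ZFSet.{0}) 2 = y :=
    fun _ _ _ => rfl
  simp only [ordFml, SatAB, Fin.cons_zero, e1, e2, e3, e4, e5, mem_toSet_iff, not_exists, not_and,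
    not_not]
  constructor
  · rintro ⟨h₁, h₂⟩
    refine ⟨fun y hy w hw => ?_, fun y hy w hw u hu => ?_⟩
    · exact h₁ y (hX _ hz hy) hy w (hX _ (hX _ hz hy) hw) hw
    · have hy' := hX _ hz hy
      have hw' := hX _ hy' hw
      exact h₂ y hy' hy w hw' hw u (hX _ hw' hu) hu
  · rintro ⟨h₁, h₂⟩
    exact ⟨fun y _ hy w _ hw => h₁ _ hy hw, fun y _ hy w _ hw u _ hu => h₂ y hy _ hw hu⟩

theorem mem_of_mem_Lz {a α γ : ZFSet.{0}} (hα : IsOrd α) (hγ : IsOrd γ) (h : α ∈ Lz a γ) :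
    α ∈ γ := by
  induction γ using ZFSet.inductionOn generalizing α with
  | _ γ ih =>
    obtain ⟨β, hβ, h⟩ := mem_Lz.1 h
    refine hγ.mem_of_subset_of_mem hα (fun z hz => ?_) hβ
    exact ih β hβ (hα.mem hz) (hγ.mem hβ) (subset_Lz_of_mem_DefP h hz)

theorem subset_Lz {a γ : ZFSet.{0}} (hγ : IsOrd γ) : γ ⊆ Lz a γ := by
  induction γ using ZFSet.inductionOn with
  | _ γ ih =>
    intro α hα
    have hα' := hγ.mem hα
    refine mem_Lz.2 ⟨α, hα, mem_DefP.2 ⟨0, ordFml, Fin.elim0, fun i => i.elim0, ?_⟩⟩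
    ext z
    rw [mem_sep]
    constructor
    · intro hz
      have := ih α hα hα' hz
      exact ⟨this, (sat_ordFml (Lz_transitive hα') this _).2 (hα'.mem hz)⟩
    · rintro ⟨h₁, h₂⟩
      exact mem_of_mem_Lz ((sat_ordFml (Lz_transitive hα') h₁ _).1 h₂) hα' h₁

/-! ### Elementary substructures -/

/-- `S` is an elementary substructure of `T` for the language of set theory. -/
def Elem (S T : Set ZFSet.{0}) : Prop :=
  ∀ {n : ℕ} (φ : Fml n) (v : Fin n → ZFSet.{0}), (∀ i, v i ∈ S) → (Sat S φ v ↔ Sat T φ v)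

theorem forall_cons_mem {S : Set ZFSet.{0}} {n : ℕ} {z : ZFSet.{0}} {v : Fin n → ZFSet.{0}}
    (hz : z ∈ S) (hv : ∀ i, v i ∈ S) (i : Fin (n + 1)) :
    (Fin.cons z v : Fin (n + 1) → ZFSet.{0}) i ∈ S := by
  refine Fin.cases ?_ (fun i => ?_) i
  · exact hz
  · exact hv i

theorem Elem.of_tarskiVaught {S T : Set ZFSet.{0}} (hST : S ⊆ T)
    (h : ∀ {n : ℕ} (φ : Fml (n + 1)) (v : Fin n → ZFSet.{0}), (∀ i, v i ∈ S) →
      (∃ z ∈ T, Sat T φ (Fin.cons z v)) → ∃ z ∈ S, Sat T φ (Fin.cons z v)) : Elem S T := by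
  intro n φ
  induction φ with
  | mem i j => intro v _; rfl
  | eq i j => intro v _; rfl
  | inA i => intro v _; rfl
  | inB i => intro v _; rfl
  | not φ ih => exact fun v hv => not_congr (ih v hv)
  | and φ ψ ih₁ ih₂ => exact fun v hv => and_congr (ih₁ v hv) (ih₂ v hv)
  | ex φ ih =>
    intro v hv
    constructor
    · rintro ⟨z, hz, hφ⟩
      exact ⟨z, hST hz, (ih _ (forall_cons_mem hz hv)).1 hφ⟩
    · intro hφ
      obtain ⟨z, hz, hφ⟩ := h φ v hv hφ
      exact ⟨z, hz, (ih _ (forall_cons_mem hz hv)).2 hφ⟩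

/-- The formula `∃ w, ∀ a ∈ d, ∃ b ∈ w, χ(a, b, p)` in the variables `d, p`. -/
def collFml {n : ℕ} (χ : Fml (n + 2)) : Fml (n + 1) :=
  .ex (.not (.ex (.and (.mem 0 2) (.not (.ex (.and (.mem 0 2)
    (χ.rename (Fin.cons 1 (Fin.cons 0 fun i => i.succ.succ.succ.succ)))))))))

theorem sat_collFml {n : ℕ} {S : Set ZFSet.{0}} (χ : Fml (n + 2)) (d : ZFSet.{0})
    (p : Fin n → ZFSet.{0}) : Sat S (collFml χ) (Fin.cons d p) ↔
      ∃ w ∈ S, ∀ a ∈ S, a ∈ d → ∃ b ∈ S, b ∈ w ∧ Sat S χ (Fin.cons a (Fin.cons b p)) := by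
  have e : ∀ w a b : ZFSet.{0},
      (fun i => (Fin.cons b (Fin.cons a (Fin.cons w (Fin.cons d p))) : Fin (n + 4) → ZFSet.{0})
        ((Fin.cons 1 (Fin.cons 0 fun i => i.succ.succ.succ.succ) : Fin (n + 2) → Fin (n + 4)) i)) =
      Fin.cons a (Fin.cons b p) := by
    intro w a b
    funext i
    refine Fin.cases rfl (fun i => Fin.cases rfl (fun i => rfl) i) i
  have e1 : ∀ w a : ZFSet.{0},
    (Fin.cons a (Fin.cons w (Fin.cons d p)) : Fin (n + 3) → ZFSet.{0}) 2 = d := fun _ _ => rfl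
  have e2 : ∀ w a b : ZFSet.{0},
    (Fin.cons b (Fin.cons a (Fin.cons w (Fin.cons d p))) : Fin (n + 4) → ZFSet.{0}) 2 = w :=
    fun _ _ _ => rfl
  simp only [collFml, Sat, SatAB, SatAB_rename, e, e1, e2, Fin.cons_zero,
    not_exists, not_and, not_not, not_forall, exists_prop]

theorem admissible_of_elem {x η γ : ZFSet.{0}} (hη : IsLimitOrd η) (hω : omega ∈ η)
    (hγ : IsOrd γ) (hηγ : η ∈ γ) (h : Elem (Lz x η).toSet (Lz x γ).toSet) : Admissible x η := by
  refine ⟨hη, hω, ?_⟩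
  rintro ⟨δ, hδ, f, ⟨n, ψ, -, p, hp, hf⟩, hfη, hcof⟩
  change ∀ i, p i ∈ Lz x η at hp
  change ∀ a b, a ∈ Lz x η → b ∈ Lz x η → (f a = b ↔ Sat (Lz x η).toSet _ _) at hf
  have hηL := subset_Lz (a := x) hη.1
  have hsub : (Lz x η).toSet ⊆ (Lz x γ).toSet := Lz_mono (hγ.1 _ hηγ)
  have hv : ∀ i, (Fin.cons δ p : Fin (n + 1) → ZFSet.{0}) i ∈ (Lz x η).toSet :=
    forall_cons_mem (hηL hδ) hp
  have hγsat : Sat (Lz x γ).toSet (collFml ψ.ex) (Fin.cons δ p) := by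
    refine (sat_collFml _ _ _).2 ⟨η, subset_Lz hγ hηγ, fun a _ ha => ?_⟩
    have haL := hηL (hη.1.1.mem_trans ha hδ)
    have hfa := hηL (hfη a ha)
    refine ⟨f a, hsub hfa, hfη a ha, ?_⟩
    exact (h _ _ (forall_cons_mem haL (forall_cons_mem hfa hp))).1 ((hf a _ haL hfa).1 rfl)
  obtain ⟨w, hw, hcol⟩ := (sat_collFml _ _ _).1 ((h _ _ hv).2 hγsat)
  obtain ⟨ρ, hρ, hwρ⟩ := mem_Lz.1 hw
  obtain ⟨β, hβ, hρβ⟩ := hcof ρ hρ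
  have hβL := hηL (hη.1.1.mem_trans hβ hδ)
  obtain ⟨b, hb, hbw, hsat⟩ := hcol β hβL hβ
  have hfb : f β = b := (hf β b hβL hb).2 hsat
  have : f β ∈ ρ := mem_of_mem_Lz (hη.1.mem (hfη β hβ)) (hη.1.mem hρ)
    (hfb ▸ subset_Lz_of_mem_DefP hwρ hbw)
  rcases hρβ with h' | h'
  · exact ZFSet.mem_asymm h' this
  · exact ZFSet.mem_irrefl _ (h' ▸ this)

/-! ### Hulls exhaust the stages -/

/-- The hulls with `ξ ∈ l` exhaust `Lz y γ`. -/
def Spans (y l γ : ZFSet.{0}) : Prop :=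
  ∀ z, z ∈ Lz y γ → ∃ ξ, ξ ∈ l ∧ z ∈ hull y l ξ γ

/-- A monotone family of properties indexed by a nonempty ordinal can be made to hold
simultaneously. -/
theorem IsOrd.exists_forall_fin {l : ZFSet.{0}} (hl : IsOrd l) (hne : l ≠ ∅) {n : ℕ}
    {p : Fin n → ZFSet.{0} → Prop} (hp : ∀ i ξ ξ', ξ ⊆ ξ' → p i ξ → p i ξ')
    (h : ∀ i, ∃ ξ ∈ l, p i ξ) : ∃ ξ ∈ l, ∀ i, p i ξ := by
  induction n with
  | zero =>
    obtain ⟨ξ, hξ⟩ := (l.eq_empty_or_nonempty).resolve_left hne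
    exact ⟨ξ, hξ, fun i => i.elim0⟩
  | succ n ih =>
    obtain ⟨ξ, hξ, h₁⟩ := ih (p := fun i => p i.succ) (fun i => hp _) fun i => h _
    obtain ⟨ξ', hξ', h₂⟩ := h 0
    rcases (hl.mem hξ).subset_or_mem (hl.mem hξ') with h' | h'
    · exact ⟨ξ', hξ', Fin.cases h₂ fun i => hp _ _ _ h' (h₁ i)⟩
    · exact ⟨ξ, hξ, Fin.cases (hp _ _ _ ((hl.mem hξ).1 _ h') h₂) h₁⟩

theorem IsOrd.exists_max {l ξ ξ' : ZFSet.{0}} (hl : IsOrd l) (hξ : ξ ∈ l) (hξ' : ξ' ∈ l) :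
    ∃ ζ ∈ l, ξ ⊆ ζ ∧ ξ' ⊆ ζ := by
  rcases (hl.mem hξ).subset_or_mem (hl.mem hξ') with h | h
  · exact ⟨ξ', hξ', h, fun _ h => h⟩
  · exact ⟨ξ, hξ, fun _ h => h, (hl.mem hξ).1 _ h⟩

section Spans
variable {y l γ : ZFSet.{0}}

theorem Spans.of_cofinal (hl : IsOrd l) (hne : l ≠ ∅) (hγ : IsOrd γ)
    (ih : ∀ ν ∈ γ, Spans y l ν)
    (hcof : ∀ μ ∈ γ, ∃ ξ ∈ l, ∃ ν ∈ idx y l ξ γ, μ ⊆ ν) : Spans y l γ := by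
  intro z hz
  obtain ⟨β, hβ, hz⟩ := mem_Lz.1 hz
  obtain ⟨ξ, hξ, ν, hν, hβν⟩ := hcof β hβ
  have hνγ := idx_subset hν
  suffices h : ∃ ξ' ∈ l, z ∈ DefE y (Lz y ν) (hull y l ξ' ν) by
    obtain ⟨ξ', hξ', h⟩ := h
    obtain ⟨ζ, hζ, h₁, h₂⟩ := hl.exists_max hξ hξ'
    exact ⟨ζ, hζ, mem_hull.2 ⟨ν, idx_mono h₁ hν, DefE_mono (hull_mono h₂) h⟩⟩
  rcases ((hγ.mem hβ).isOrdinal.subset_iff_eq_or_mem (hγ.mem hνγ).isOrdinal).1 hβν with rfl | hβν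
  · obtain ⟨n, φ, v, hv, rfl⟩ := mem_DefP.1 hz
    obtain ⟨ξ', hξ', h⟩ := hl.exists_forall_fin hne (p := fun i ξ => v i ∈ hull y l ξ β)
      (fun i _ _ h h' => hull_mono h h') fun i => ih β hβ _ (hv i)
    exact ⟨ξ', hξ', mem_DefP.2 ⟨n, φ, v, fun i => mem_insert_iff.2 (.inr (h i)), rfl⟩⟩
  · have hzν : z ∈ Lz y ν := mem_Lz.2 ⟨β, hβν, hz⟩
    obtain ⟨ξ', hξ', h⟩ := ih ν hνγ z hzν
    exact ⟨ξ', hξ', mem_DefP_self (Lz_transitive (hγ.mem hνγ)) hzν (mem_insert_iff.2 (.inr h))⟩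

theorem exists_leastHit {B : ZFSet.{0}} (hγ : IsOrd γ)
    (h : ∃ ν ∈ γ, ∃ z ∈ B, z ∈ Lz y ν) : ∃ ν ∈ γ, LeastHit y B ν := by
  obtain ⟨ν, hν, h⟩ := h
  induction ν using ZFSet.inductionOn with
  | _ ν ih =>
    by_cases h' : ∃ μ ∈ ν, ∃ z ∈ B, z ∈ Lz y μ
    · obtain ⟨μ, hμ, h'⟩ := h'
      exact ih μ hμ (hγ.1.mem_trans hμ hν) h'
    · push Not at h'
      exact ⟨ν, hν, h, fun μ hμ ⟨z, h₁, h₂⟩ => h' μ hμ z h₁ h₂⟩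

/-- The indices used for some `ξ ∈ l`. -/
def IdxUnion (y l γ ν : ZFSet.{0}) : Prop := ∃ ξ ∈ l, ν ∈ idx y l ξ γ

/-- If the indices are bounded in `γ`, then their supremum is an elementary stage. -/
theorem exists_elem_of_bounded (hl : IsOrd l) (hne : l ≠ ∅) (hγ : IsOrd γ)
    (ih : ∀ ν ∈ γ, Spans y l ν) {μ : ZFSet.{0}} (hμ : μ ∈ γ)
    (hb : ∀ ν, IdxUnion y l γ ν → ¬ μ ⊆ ν) :
    ∃ η ∈ γ, l ∈ η ∧ IsLimitOrd η ∧ Elem (Lz y η).toSet (Lz y γ).toSet := by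
  have hKγ : ∀ {ν}, IdxUnion y l γ ν → ν ∈ γ := fun ⟨_, _, h⟩ => idx_subset h
  have hKμ : ∀ {ν}, IdxUnion y l γ ν → ν ∈ μ := fun h =>
    ((hγ.mem hμ).subset_or_mem (hγ.mem (hKγ h))).resolve_left (hb _ h)
  have hsucc : ∀ {ν}, IdxUnion y l γ ν → IdxUnion y l γ (insert ν ν) := by
    intro ν h
    have h' := hγ.mem_of_subset_of_mem (hγ.mem (hKγ h)).succ
      ((hγ.mem hμ).succ_subset (hKμ h)) hμ
    obtain ⟨ξ, hξ, h⟩ := h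
    exact ⟨ξ, hξ, idx_next h h' (.inl rfl)⟩
  obtain ⟨ξ₀, hξ₀⟩ := (l.eq_empty_or_nonempty).resolve_left hne
  have hlγ : l ∈ γ := by
    refine (hγ.subset_or_mem hl).resolve_left fun hsub => ?_
    by_cases hs : insert μ μ ∈ l
    · exact hb μ ⟨_, hs, idx_base hμ (.inl (mem_insert_iff.2 (.inl rfl)))⟩ fun _ h => h
    · have hle := (hl.subset_or_mem (hγ.mem hμ).succ).resolve_right hs
      have : γ = insert μ μ := by
        ext z
        exact ⟨fun h => hle (hsub h), fun h => hγ.succ_subset hμ h⟩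
      exact hb μ ⟨ξ₀, hξ₀, idx_base hμ (.inr (.inr this))⟩ fun _ h => h
  have hlK : IdxUnion y l γ l := ⟨ξ₀, hξ₀, idx_base hlγ (.inr (.inl rfl))⟩
  let η := ZFSet.sep (fun β => ∃ ν, IdxUnion y l γ ν ∧ β ∈ ν) γ
  have hKη : ∀ {ν}, IdxUnion y l γ ν → ν ∈ η := fun h =>
    mem_sep.2 ⟨hKγ h, _, hsucc h, mem_insert_iff.2 (.inl rfl)⟩
  have hη : IsOrd η := by
    refine ⟨fun β hβ z hz => ?_, fun β hβ => hγ.2 _ (mem_sep.1 hβ).1⟩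
    obtain ⟨hβγ, ν, hν, hβν⟩ := mem_sep.1 hβ
    exact mem_sep.2 ⟨hγ.1.mem_trans hz hβγ, ν, hν, (hγ.mem (hKγ hν)).1.mem_trans hz hβν⟩
  have hημ : η ⊆ μ := fun β hβ => by
    obtain ⟨-, ν, hν, hβν⟩ := mem_sep.1 hβ
    exact (hγ.mem hμ).1.mem_trans hβν (hKμ hν)
  have hηγ := hγ.mem_of_subset_of_mem hη hημ hμ
  have hlim : IsLimitOrd η := by
    refine ⟨hη, fun h => ?_, fun β hβ => ?_⟩
    · exact ZFSet.notMem_empty _ (h ▸ hKη hlK)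
    · obtain ⟨-, ν, hν, hβν⟩ := mem_sep.1 hβ
      exact ⟨ν, hKη hν, hβν⟩
  have hγsucc : ∀ β ∈ γ, insert β β ∈ γ := by
    intro β hβ
    by_contra hs
    have hle := (hγ.subset_or_mem (hγ.mem hβ).succ).resolve_right hs
    have hγeq : γ = insert β β := by
      ext z
      exact ⟨fun h => hle h, fun h => hγ.succ_subset hβ h⟩
    refine hb β ⟨ξ₀, hξ₀, idx_base hβ (.inr (.inr hγeq))⟩ ?_
    rcases mem_insert_iff.1 (hle hμ) with rfl | h
    · exact fun _ h => h
    · exact (hγ.mem hβ).1 _ h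
  refine ⟨η, hηγ, hKη hlK, hlim, Elem.of_tarskiVaught (Lz_mono (hγ.1 _ hηγ)) ?_⟩
  intro n φ v hv ⟨z, hz, hφ⟩
  -- All parameters lie in a single stage whose index is generated.
  obtain ⟨ρ, hρ, hvρ⟩ := hη.exists_forall_fin hlim.2.1 (p := fun i ρ => v i ∈ Lz y ρ)
    (fun i _ _ h h' => Lz_mono h h') fun i => by
      obtain ⟨β, hβ, h⟩ := mem_Lz.1 (show v i ∈ Lz y η from hv i)
      obtain ⟨β', hβ', h'⟩ := hlim.2.2 β hβ
      exact ⟨β', hβ', mem_Lz.2 ⟨β, h', h⟩⟩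
  obtain ⟨hργ, ν, hν, hρν⟩ := mem_sep.1 hρ
  have hvν : ∀ i, v i ∈ Lz y ν := fun i => Lz_mono ((hγ.mem (hKγ hν)).1 _ hρν) (hvρ i)
  obtain ⟨ξ₁, hξ₁, hvξ⟩ := hl.exists_forall_fin hne (p := fun i ξ => v i ∈ hull y l ξ ν)
    (fun i _ _ h h' => hull_mono h h') fun i => ih ν (hKγ hν) _ (hvν i)
  obtain ⟨ξ₂, hξ₂, hν₂⟩ := id hν
  obtain ⟨ξ, hξ, h₁, h₂⟩ := hl.exists_max hξ₁ hξ₂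
  let B := ZFSet.sep (fun z => Sat (Lz y γ).toSet φ (Fin.cons z v)) (Lz y γ)
  have hzB : z ∈ B := mem_sep.2 ⟨hz, hφ⟩
  have hB : B ∈ DefE ∅ (Lz y γ) (hull y l ξ ν) := by
    refine mem_DefP.2 ⟨n, φ, v, fun i => mem_insert_iff.2 (.inr (hull_mono h₁ (hvξ i))), ?_⟩
    have : (∅ : ZFSet.{0}).toSet = ∅ := by ext; simp [mem_toSet_iff]
    rw [this]; rfl
  obtain ⟨β, hβ, hzβ⟩ := mem_Lz.1 hz
  obtain ⟨ν', hν', hhit⟩ := exists_leastHit (y := y) (B := B) hγ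
    ⟨_, hγsucc β hβ, z, hzB, mem_Lz.2 ⟨β, mem_insert_iff.2 (.inl rfl), hzβ⟩⟩
  have hν'K : IdxUnion y l γ ν' :=
    ⟨ξ, hξ, idx_next (idx_mono h₂ hν₂) hν' (.inr ⟨B, hB, hhit⟩)⟩
  obtain ⟨z', hz'B, hz'⟩ := hhit.1
  exact ⟨z', Lz_mono (hη.1 _ (hKη hν'K)) hz', (mem_sep.1 hz'B).2⟩

/-- If every `y`-admissible ordinal above `l` is not spanned then all ordinals are spanned. -/
theorem spans_of_admissible (hl : IsOrd l) (hω : omega ∈ l)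
    (h : ∀ η, Admissible y η → l ∈ η → ¬ Spans y l η) (hγ : IsOrd γ) : Spans y l γ := by
  have hne : l ≠ ∅ := fun h => ZFSet.notMem_empty _ (h ▸ hω)
  induction γ using ZFSet.inductionOn with
  | _ γ ih =>
    have ih' : ∀ ν ∈ γ, Spans y l ν := fun ν hν => ih ν hν (hγ.mem hν)
    refine Spans.of_cofinal hl hne hγ ih' fun μ hμ => ?_
    by_contra hcon
    obtain ⟨η, hηγ, hlη, hlim, hel⟩ := exists_elem_of_bounded hl hne hγ ih' hμ
      fun ν ⟨ξ, hξ, hν⟩ hμν => hcon ⟨ξ, hξ, ν, hν, hμν⟩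
    exact h η (admissible_of_elem hlim (hlim.1.1.mem_trans hω hlη) hγ hηγ hel) hlη (ih' η hηγ)

end Spans

/-! ### Collapsing spanned ordinals in `HOD` -/

/-- The elements of `η` in a hull of `ξ` for some real. -/
def hullOrd (l η ξ : ZFSet.{0}) : ZFSet.{0} :=
  ZFSet.sep (fun ζ => ∃ y, y ∈ ZFSet.powerset omega ∧ ζ ∈ hull y l ξ η) η

/-- The elements of `hullOrd l η ξ` not among the first `ν` values of `f`. -/
def remaining (l η ν f ξ : ZFSet.{0}) : ZFSet.{0} :=
  ZFSet.sep (fun ζ => ∀ μ, μ ∈ ν → ¬ app f μ = ζ) (hullOrd l η ξ)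

/-- `ζ` is the least remaining element for the least `ξ ∈ l` with a remaining element. -/
def Pick (l η ν f ζ : ZFSet.{0}) : Prop :=
  ∃ ξ, ξ ∈ l ∧ ζ ∈ remaining l η ν f ξ ∧ (∀ ξ', ξ' ∈ ξ → remaining l η ν f ξ' = ∅) ∧
    ∀ ζ', ζ' ∈ ζ → ¬ ζ' ∈ remaining l η ν f ξ

/-- An enumeration of `⋃ ξ ∈ l, hullOrd l η ξ`. -/
def enum (l η ν : ZFSet.{0}) : ZFSet.{0} :=
  recZ (fun ν f => ZFSet.sUnion (ZFSet.sep (fun ζ => Pick l η ν f ζ) η)) ν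

section Definability
variable {n : ℕ} (a b c d e : (Fin n → ZFSet.{0}) → ZFSet.{0})

instance DF.instHullOrd [ha : DF a] [hb : DF b] [hc : DF c] :
    DF (fun v => hullOrd (a v) (b v) (c v)) :=
  .comp₃ (f := fun a b c => hullOrd a b c) (by unfold hullOrd; infer_instance) ha hb hc

instance DF.instRemaining [ha : DF a] [hb : DF b] [hc : DF c] [hd : DF d] [he : DF e] :
    DF (fun v => remaining (a v) (b v) (c v) (d v) (e v)) :=
  .comp₅ (f := fun a b c d e => remaining a b c d e) (by unfold remaining; infer_instance)
    ha hb hc hd he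

instance Dfn.instPick [ha : DF a] [hb : DF b] [hc : DF c] [hd : DF d] [he : DF e] :
    Dfn (fun v => Pick (a v) (b v) (c v) (d v) (e v)) :=
  .comp₅ (R := fun a b c d e => Pick a b c d e) (by unfold Pick; infer_instance)
    ha hb hc hd he

instance DF.instEnum [ha : DF a] [hb : DF b] [hc : DF c] :
    DF (fun v => enum (a v) (b v) (c v)) :=
  .comp₃ (f := fun a b c => enum a b c) (by unfold enum; infer_instance) ha hb hc

end Definability

section Enum
variable {l η : ZFSet.{0}}

theorem hullOrd_mono {ξ ξ' : ZFSet.{0}} (h : ξ ⊆ ξ') : hullOrd l η ξ ⊆ hullOrd l η ξ' := by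
  intro ζ hζ
  obtain ⟨h₁, y, hy, h₂⟩ := mem_sep.1 hζ
  exact mem_sep.2 ⟨h₁, y, hy, hull_mono h h₂⟩

theorem small_hullOrd {ξ : ZFSet.{0}} (hη : IsOrd η) (hξ : Small ξ) : Small (hullOrd l η ξ) := by
  refine (Small.powerset_omega.sUnion_img (fun y => hull y l ξ η)
    fun y _ => Small.hull hη hξ).mono fun ζ hζ => ?_
  obtain ⟨-, y, hy, h⟩ := mem_sep.1 hζ
  exact mem_sUnion.2 ⟨_, mem_img.2 ⟨y, hy, rfl⟩, h⟩

theorem Pick.unique {ν f ζ ζ' : ZFSet.{0}} (hl : IsOrd l) (hη : IsOrd η)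
    (h : Pick l η ν f ζ) (h' : Pick l η ν f ζ') : ζ = ζ' := by
  obtain ⟨ξ, hξ, h₁, h₂, h₃⟩ := h
  obtain ⟨ξ', hξ', h₁', h₂', h₃'⟩ := h'
  have : ξ = ξ' := by
    rcases (hl.mem hξ).isOrdinal.mem_trichotomous (hl.mem hξ').isOrdinal with h | h | h
    · exact (ZFSet.notMem_empty _ (h₂' _ h ▸ h₁)).elim
    · exact h
    · exact (ZFSet.notMem_empty _ (h₂ _ h ▸ h₁')).elim
  subst this
  have hζ := hη.mem (mem_sep.1 (mem_sep.1 h₁).1).1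
  have hζ' := hη.mem (mem_sep.1 (mem_sep.1 h₁').1).1
  rcases hζ.isOrdinal.mem_trichotomous hζ'.isOrdinal with h | h | h
  · exact (h₃' _ h h₁).elim
  · exact h
  · exact (h₃ _ h h₁').elim

theorem exists_mem_minimal {p : ZFSet.{0} → Prop} {z : ZFSet.{0}} (h : p z) :
    ∃ w, p w ∧ ∀ u ∈ w, ¬ p u := by
  induction z using ZFSet.inductionOn with
  | _ z ih =>
    by_cases h' : ∃ u ∈ z, p u
    · obtain ⟨u, hu, hpu⟩ := h'
      exact ih u hu hpu
    · exact ⟨z, h, fun u hu hpu => h' ⟨u, hu, hpu⟩⟩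

theorem exists_pick {ν f ξ ζ : ZFSet.{0}} (hl : IsOrd l) (hξ : ξ ∈ l)
    (h : ζ ∈ remaining l η ν f ξ) : ∃ ζ', Pick l η ν f ζ' ∧ ζ' ∈ remaining l η ν f ξ := by
  obtain ⟨ξ', ⟨hξ', ⟨ζ₁, hζ₁⟩⟩, hmin⟩ := exists_mem_minimal
    (p := fun ξ => ξ ∈ l ∧ ∃ ζ, ζ ∈ remaining l η ν f ξ) (z := ξ) ⟨hξ, ζ, h⟩
  obtain ⟨ζ', hζ', hmin'⟩ := exists_mem_minimal
    (p := fun ζ => ζ ∈ remaining l η ν f ξ') hζ₁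
  have hle : ξ' ⊆ ξ := ((hl.mem hξ').subset_or_mem (hl.mem hξ)).resolve_right
    fun h' => hmin ξ h' ⟨hξ, ζ, h⟩
  refine ⟨ζ', ⟨ξ', hξ', hζ', fun ξ'' h'' => ?_, hmin'⟩, ?_⟩
  · refine ((remaining l η ν f ξ'').eq_empty_or_nonempty).resolve_right fun ⟨ζ, hζ⟩ => ?_
    exact hmin ξ'' h'' ⟨hl.1.mem_trans h'' hξ', ζ, hζ⟩
  · obtain ⟨h₁, h₂⟩ := mem_sep.1 hζ'
    exact mem_sep.2 ⟨hullOrd_mono hle h₁, h₂⟩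

theorem enum_eq_of_pick {ν ζ : ZFSet.{0}} (hl : IsOrd l) (hη : IsOrd η)
    (h : Pick l η ν (graph (enum l η) ν) ζ) : enum l η ν = ζ := by
  rw [enum, recZ_eq]
  change ZFSet.sUnion (ZFSet.sep (fun ζ => Pick l η ν (graph (enum l η) ν) ζ) η) = ζ
  have : ZFSet.sep (fun ζ => Pick l η ν (graph (enum l η) ν) ζ) η = {ζ} := by
    ext ζ'
    rw [mem_sep, mem_singleton]
    refine ⟨fun h' => h'.2.unique hl hη h, ?_⟩
    rintro rfl
    obtain ⟨_, _, h₁, _⟩ := id h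
    exact ⟨(mem_sep.1 (mem_sep.1 h₁).1).1, h⟩
  rw [this, ZFSet.sUnion_singleton]

theorem enum_mem (hl : IsOrd l) (hη : IsOrd η) (hne : ∅ ∈ η) (ν : ZFSet.{0}) :
    enum l η ν ∈ η := by
  by_cases h : ∃ ζ, Pick l η ν (graph (enum l η) ν) ζ
  · obtain ⟨ζ, h⟩ := h
    rw [enum_eq_of_pick hl hη h]
    obtain ⟨_, _, h₁, _⟩ := h
    exact (mem_sep.1 (mem_sep.1 h₁).1).1
  · rw [enum, recZ_eq]
    change ZFSet.sUnion (ZFSet.sep (fun ζ => Pick l η ν (graph (enum l η) ν) ζ) η) ∈ η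
    have : ZFSet.sep (fun ζ => Pick l η ν (graph (enum l η) ν) ζ) η = ∅ := by
      refine (ZFSet.eq_empty _).2 fun ζ hζ => h ⟨ζ, (mem_sep.1 hζ).2⟩
    rw [this, ZFSet.sUnion_empty]
    exact hne

theorem exists_enum_eq {ξ ζ : ZFSet.{0}} (hl : IsOrd l) (hη : IsOrd η)
    (hsmall : ∀ ξ ∈ l, Small ξ) (hbig : ¬ Small l) (hξ : ξ ∈ l) (hζ : ζ ∈ hullOrd l η ξ) :
    ∃ ν ∈ l, enum l η ν = ζ := by
  by_contra hcon
  push Not at hcon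
  have key : ∀ ν ∈ l, enum l η ν ∈ remaining l η ν (graph (enum l η) ν) ξ := by
    intro ν hν
    have hrem : ζ ∈ remaining l η ν (graph (enum l η) ν) ξ := by
      refine mem_sep.2 ⟨hζ, fun μ hμ => ?_⟩
      rw [app_graph hμ]
      exact hcon μ (hl.1.mem_trans hμ hν)
    obtain ⟨ζ', hp, h⟩ := exists_pick hl hξ hrem
    rwa [enum_eq_of_pick hl hη hp]
  have hne : ∀ ν ∈ l, ∀ μ ∈ ν, enum l η μ ≠ enum l η ν := by
    intro ν hν μ hμ h
    refine (mem_sep.1 (key ν hν)).2 μ hμ ?_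
    rw [app_graph hμ, h]
  refine hbig ?_
  have hinj : Set.InjOn (enum l η) l.toSet := by
    intro ν hν μ hμ h
    rcases (hl.mem hν).isOrdinal.mem_trichotomous (hl.mem hμ).isOrdinal with h' | h' | h'
    · exact (hne _ hμ _ h' h).elim
    · exact h'
    · exact (hne _ hν _ h' h.symm).elim
  rw [Small, ← Cardinal.mk_image_eq_of_injOn _ _ hinj]
  refine (Cardinal.mk_le_mk_of_subset ?_).trans (small_hullOrd (l := l) hη (hsmall ξ hξ))
  rintro _ ⟨ν, hν, rfl⟩
  exact (mem_sep.1 (key ν hν)).1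

theorem not_cardIn_HODClass {x : ZFSet.{0}} (hl : IsOrd l) (hsmall : ∀ ξ ∈ l, Small ξ)
    (hbig : ¬ Small l) (hx : x ⊆ omega) (hlη : l ∈ η) (hsp : Spans x l η) :
    ¬ CardIn HODClass η := by
  rintro ⟨hη, hcard⟩
  have hne : ∅ ∈ η := by
    refine hη.mem_of_subset_of_mem ⟨?_, ?_⟩ (fun z hz => absurd hz (ZFSet.notMem_empty z)) hlη
    · exact fun z hz => absurd hz (ZFSet.notMem_empty z)
    · exact fun z hz => absurd hz (ZFSet.notMem_empty z)
  have hv : ∀ i, IsOrd ((![l, η] : Fin 2 → ZFSet.{0}) i) := by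
    simp [Fin.forall_fin_two, hl, hη]
  have hmem : ∀ {z}, z ∈ graph (enum l η) l ↔ ∃ ν ∈ l, ZFSet.pair ν (enum l η ν) = z := mem_img
  refine hcard l hlη (graph (enum l η) l) (mem_HODClass ?_ ?_) ⟨⟨?_, ?_⟩, ?_⟩
  · exact isOD_of_DF (fun v : Fin 2 → ZFSet.{0} => graph (enum (v 0) (v 1)) (v 0)) ![l, η] hv
  · intro z hz
    obtain ⟨ν, hν, rfl⟩ := hmem.1 hz
    exact pair_mem_HODClass (hl.mem hν) (hη.mem (enum_mem hl hη hne ν))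
  · intro z hz
    obtain ⟨ν, hν, rfl⟩ := hmem.1 hz
    exact ZFSet.pair_mem_prod.2 ⟨hν, enum_mem hl hη hne ν⟩
  · intro ν hν
    refine ⟨enum l η ν, pair_mem_graph.2 ⟨hν, rfl⟩, fun w hw => (pair_mem_graph.1 hw).2⟩
  · intro ζ hζ
    obtain ⟨ξ, hξ, h⟩ := hsp ζ (subset_Lz hη hζ)
    obtain ⟨ν, hν, rfl⟩ := exists_enum_eq hl hη hsmall hbig hξ
      (mem_sep.2 ⟨hζ, x, mem_powerset.2 hx, h⟩)
    exact ⟨ν, hν, pair_mem_graph.2 ⟨hν, rfl⟩⟩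

end Enum

open Cardinal Ordinal in
theorem mk_toZFSet_ord (κ : Cardinal.{0}) : #κ.ord.toZFSet.toSet = Cardinal.lift.{1} κ := by
  have : κ.ord.toZFSet.toSet = Ordinal.toZFSet '' Set.Iio κ.ord := coe_toZFSet
  rw [this, Cardinal.mk_image_eq toZFSet_injective, Cardinal.mk_Iio_ordinal, Cardinal.card_ord]

open Cardinal in
theorem exists_ord_succ_continuum : ∃ l : ZFSet.{0}, IsOrd l ∧ (∀ ξ ∈ l, Small ξ) ∧
    #l.toSet = Order.succ 𝔠 := by
  refine ⟨(Order.succ (𝔠 : Cardinal.{0})).ord.toZFSet,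
    isOrd_iff.2 (ZFSet.isOrdinal_toZFSet _), fun ξ hξ => ?_, ?_⟩
  · obtain ⟨o, ho, rfl⟩ := Ordinal.mem_toZFSet_iff.1 hξ
    have hc : o.card ≤ 𝔠 := Order.lt_succ_iff.1 (Cardinal.lt_ord.1 ho)
    have : (Ordinal.toZFSet o).toSet = Ordinal.toZFSet '' Set.Iio o := Ordinal.coe_toZFSet
    rw [Small, this, Cardinal.mk_image_eq Ordinal.toZFSet_injective, Cardinal.mk_Iio_ordinal]
    exact Cardinal.lift_le_continuum.2 hc
  · rw [mk_toZFSet_ord, Cardinal.lift_succ, Cardinal.lift_continuum]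

open Cardinal in
theorem not_forall_spans {x l : ZFSet.{0}} (hsmall : ∀ ξ ∈ l, Small ξ)
    (hcard : #l.toSet = Order.succ 𝔠) : ¬ ∀ γ, IsOrd γ → Spans x l γ := by
  intro h
  set γ := (Order.succ (Order.succ (𝔠 : Cardinal.{0}))).ord.toZFSet with hγdef
  have hγ : IsOrd γ := isOrd_iff.2 (ZFSet.isOrdinal_toZFSet _)
  have hγcard : #γ.toSet = Order.succ (Order.succ 𝔠) := by
    rw [hγdef, mk_toZFSet_ord, Cardinal.lift_succ, Cardinal.lift_succ, Cardinal.lift_continuum]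
  have hsub : γ.toSet ⊆ ⋃ ξ ∈ l.toSet, (hull x l ξ γ).toSet := by
    intro z hz
    obtain ⟨ξ, hξ, hz⟩ := h γ hγ z (subset_Lz hγ hz)
    exact Set.mem_biUnion (show ξ ∈ l.toSet from hξ) hz
  have hle : #γ.toSet ≤ Order.succ 𝔠 := by
    refine (Cardinal.mk_le_mk_of_subset hsub).trans ((Cardinal.mk_biUnion_le _ _).trans ?_)
    refine (mul_le_mul' hcard.le (ciSup_le' fun ξ : l.toSet =>
      (Small.hull hγ (hsmall ξ ξ.2)).trans (Order.le_succ 𝔠))).trans ?_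
    exact (Cardinal.mul_eq_self (Cardinal.aleph0_le_continuum.trans (Order.le_succ _))).le
  rw [hγcard] at hle
  exact (Order.lt_succ (Order.succ (𝔠 : Cardinal.{1}))).not_ge hle

theorem isOrd_natZ (n : ℕ) : IsOrd (natZ n) := by
  induction n with
  | zero =>
    exact ⟨fun z hz => absurd hz (ZFSet.notMem_empty z),
      fun z hz => absurd hz (ZFSet.notMem_empty z)⟩
  | succ n ih => exact ih.succ

theorem natZ_subset_omega (n : ℕ) : natZ n ⊆ omega := by
  induction n with
  | zero => exact fun z hz => absurd hz (ZFSet.notMem_empty z)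
  | succ n ih =>
    intro z hz
    rcases mem_insert_iff.1 hz with rfl | hz
    · exact natZ_mem_omega n
    · exact ih hz

theorem isOrd_omega : IsOrd omega := by
  refine ⟨fun z hz => ?_, fun z hz => ?_⟩
  · obtain ⟨n, rfl⟩ := mem_omega_iff.1 hz
    exact natZ_subset_omega n
  · obtain ⟨n, rfl⟩ := mem_omega_iff.1 hz
    exact (isOrd_natZ n).1

theorem not_HPclass_HODClass : ¬ HPclass HODClass := by
  rintro ⟨x, hx, hHP⟩
  obtain ⟨l, hl, hsmall, hcard⟩ := exists_ord_succ_continuum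
  have hbig : ¬ Small l := by
    rw [Small, hcard]
    exact (Order.lt_succ _).not_ge
  have hω : ZFSet.omega ∈ l := by
    exact (hl.subset_or_mem isOrd_omega).resolve_left fun h => hbig (Small.omega.mono h)
  exact not_forall_spans hsmall hcard fun γ hγ => spans_of_admissible hl hω
    (fun η hη hlη hsp => not_cardIn_HODClass hl hsmall hbig hx hlη hsp (hHP η hη)) hγ

/-! ## The statement -/

/-- Theorem 3.15: under `AD^{L(ℝ)}`, `HP(HOD)` does not hold. -/
theorem statement17 (had : ADinLR) : ¬ HPclass HODClass := by
  exact not_HPclass_HODClass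

end SRPPaper
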